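/- For every node expression η of regXPath(𝔙,=) over a finite alphabet 𝔸 there exists a BUDTA A over 𝔸, effectively computable from η, that is equivalent to η: for every data tree τ over 𝔸 and 𝔻, A accepts τ if and only if η holds at some position of τ. -/

import Mathlib

namespace XPB

/-- Positions in an unranked tree: finite sequences of natural numbers
(each number is the index of a child). -/
abbrev Pos : Type := List ℕ

/-- A data tree over a label alphabet `A` and data domain `D`:
a finite, prefix-closed, left-sibling-closed set of positions,
each carrying a label and a datum. -/
structure DataTree (A D : Type) where
  pos : Finset Pos
  label : Pos → A
  data : Pos → D
  root_mem : ([] : Pos) ∈ pos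
  parent_closed : ∀ (x : Pos) (i : ℕ), x ++ [i] ∈ pos → x ∈ pos
  sibling_closed : ∀ (x : Pos) (i : ℕ), x ++ [i + 1] ∈ pos → x ++ [i] ∈ pos

mutual
  /-- Path expressions of vertical regXPath(𝔙,=). -/
  inductive PathE (A : Type) : Type where
    | eps : PathE A
    | down : PathE A
    | up : PathE A
    | testR : PathE A → NodeE A → PathE A      -- α[φ]
    | testL : NodeE A → PathE A → PathE A      -- [φ]α
    | comp : PathE A → PathE A → PathE A       -- αβ
    | union : PathE A → PathE A → PathE A      -- α ∪ β
    | star : PathE A → PathE A                 -- α*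
  /-- Node expressions of vertical regXPath(𝔙,=). -/
  inductive NodeE (A : Type) : Type where
    | lab : A → NodeE A
    | not : NodeE A → NodeE A
    | and : NodeE A → NodeE A → NodeE A
    | or : NodeE A → NodeE A → NodeE A
    | somePath : PathE A → NodeE A             -- ⟨α⟩
    | eqTest : PathE A → PathE A → NodeE A     -- ⟨α = β⟩
    | neqTest : PathE A → PathE A → NodeE A    -- ⟨α ≠ β⟩
end

mutual
  /-- The binary relation on positions denoted by a path expression. -/
  def pathSem {A D : Type} (τ : DataTree A D) : PathE A → Pos → Pos → Prop
    | .eps => fun x y => x ∈ τ.pos ∧ y = x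
    | .down => fun x y => y ∈ τ.pos ∧ ∃ i : ℕ, y = x ++ [i]
    | .up => fun x y => x ∈ τ.pos ∧ ∃ i : ℕ, x = y ++ [i]
    | .testR α φ => fun x y => pathSem τ α x y ∧ nodeSem τ φ y
    | .testL φ α => fun x y => nodeSem τ φ x ∧ pathSem τ α x y
    | .comp α β => fun x z => ∃ y, pathSem τ α x y ∧ pathSem τ β y z
    | .union α β => fun x y => pathSem τ α x y ∨ pathSem τ β x y
    | .star α => fun x y => x ∈ τ.pos ∧ Relation.ReflTransGen (pathSem τ α) x y
  /-- The set of positions at which a node expression holds. -/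
  def nodeSem {A D : Type} (τ : DataTree A D) : NodeE A → Pos → Prop
    | .lab a => fun x => x ∈ τ.pos ∧ τ.label x = a
    | .not φ => fun x => x ∈ τ.pos ∧ ¬ nodeSem τ φ x
    | .and φ ψ => fun x => nodeSem τ φ x ∧ nodeSem τ ψ x
    | .or φ ψ => fun x => nodeSem τ φ x ∨ nodeSem τ ψ x
    | .somePath α => fun x => ∃ y, pathSem τ α x y
    | .eqTest α β => fun x => ∃ y z, pathSem τ α x y ∧ pathSem τ β x z ∧ τ.data y = τ.data z
    | .neqTest α β => fun x => ∃ y z, pathSem τ α x y ∧ pathSem τ β x z ∧ τ.data y ≠ τ.data z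
end
/-- `x` is a leaf of `τ`. -/
def IsLeaf {A D : Type} (τ : DataTree A D) (x : Pos) : Prop :=
  ∀ i : ℕ, x ++ [i] ∉ τ.pos

/-- `p` is a downward path of `τ` starting at `x`: a nonempty sequence of
positions of `τ`, starting at `x`, in which each step goes from a node to one
of its children. -/
def IsDownPath {A D : Type} (τ : DataTree A D) (x : Pos) (p : List Pos) : Prop :=
  p ≠ [] ∧ p.head? = some x ∧ (∀ y ∈ p, y ∈ τ.pos) ∧
    List.Chain' (fun y z => ∃ i : ℕ, z = y ++ [i]) p

/-- The data values occurring in the subtree rooted at `x`. -/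
def subtreeData {A D : Type} (τ : DataTree A D) (x : Pos) : Set D :=
  {d | ∃ y ∈ τ.pos, x <+: y ∧ τ.data y = d}

/-- Basic tests of a BUDTA, over alphabet `A`, internal alphabet `B`, states `Q`. -/
inductive BTest (A B Q : Type) : Type where
  | state : Q → BTest A B Q                                 -- p
  | eq : BTest A B Q                                        -- eq
  | deq : RegularExpression (A × B) → BTest A B Q           -- ⟨e⟩^=
  | dneq : RegularExpression (A × B) → BTest A B Q          -- ⟨e⟩^≠
  | root : BTest A B Q
  | leaf : BTest A B Q
  | lab : A → BTest A B Q                                   -- a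
  | ilab : B → BTest A B Q                                  -- b

/-- Basic actions of a BUDTA. -/
inductive BAct (Q : Type) : Type where
  | accept : BAct Q
  | keep : Q → BAct Q
  | store : Q → BAct Q
  | guess : Q → BAct Q
  | univ : Q → BAct Q

/-- A transition: a conjunction of possibly negated basic tests (the Boolean
flag `true` marks a negated test) together with a conjunction of basic actions. -/
abbrev Trans (A B Q : Type) : Type := List (Bool × BTest A B Q) × List (BAct Q)

/-- Satisfaction of a basic test by the thread `(q, d)` at position `x` of the
tree `τ` with internal labeling `bl`. -/
def basicHolds {A B Q D : Type} (τ : DataTree A D) (bl : Pos → B) (x : Pos)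
    (q : Q) (d : D) : BTest A B Q → Prop
  | .state p => q = p
  | .eq => τ.data x = d
  | .deq e => ∃ p y, IsDownPath τ x p ∧ p.getLast? = some y ∧
      (p.map fun z => (τ.label z, bl z)) ∈ e.matches' ∧ τ.data y = d
  | .dneq e => ∃ p y, IsDownPath τ x p ∧ p.getLast? = some y ∧
      (p.map fun z => (τ.label z, bl z)) ∈ e.matches' ∧ τ.data y ≠ d
  | .root => x = ([] : Pos)
  | .leaf => IsLeaf τ x
  | .lab a => τ.label x = a
  | .ilab b => bl x = b

/-- Satisfaction of a conjunction of possibly negated basic tests. -/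
def testHolds {A B Q D : Type} (τ : DataTree A D) (bl : Pos → B) (x : Pos)
    (q : Q) (d : D) (t : List (Bool × BTest A B Q)) : Prop :=
  ∀ nt ∈ t, (basicHolds τ bl x q d nt.2 ↔ nt.1 = false)

/-- The constraint imposed on the configuration `ρ y` of the parent `y` of `x`
by a basic action executed at `x` by a thread with register value `d`. -/
def actOK {A Q D : Type} (τ : DataTree A D) (x y : Pos)
    (ρ : Pos → Set (Q × D)) (d : D) : BAct Q → Prop
  | .accept => True
  | .keep p => (p, d) ∈ ρ y
  | .store p => (p, τ.data x) ∈ ρ y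
  | .guess p => ∃ e : D, (p, e) ∈ ρ y
  | .univ p => ∀ e ∈ subtreeData τ x, (p, e) ∈ ρ y

/-- `ρ` is a run of the automaton with initial state `q0` and transitions `δ`
on the tree `τ` with internal labeling `bl`. -/
def IsRun {A B Q D : Type} (q0 : Q) (δ : List (Trans A B Q))
    (τ : DataTree A D) (bl : Pos → B) (ρ : Pos → Set (Q × D)) : Prop :=
  (∀ x ∈ τ.pos, (ρ x).Finite) ∧
  (∀ x ∈ τ.pos, IsLeaf τ x → ∃ e : D, ρ x = {(q0, e)}) ∧
  (∀ (y : Pos) (i : ℕ), y ++ [i] ∈ τ.pos → ∀ qd ∈ ρ (y ++ [i]),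
    ∃ tr ∈ δ, testHolds τ bl (y ++ [i]) qd.1 qd.2 tr.1 ∧
      ∀ a ∈ tr.2, actOK τ (y ++ [i]) y ρ qd.2 a)

/-- `ρ` is an accepting run: a run in which every root thread satisfies the
test of some transition whose action is `accept`. -/
def IsAcceptingRun {A B Q D : Type} (q0 : Q) (δ : List (Trans A B Q))
    (τ : DataTree A D) (bl : Pos → B) (ρ : Pos → Set (Q × D)) : Prop :=
  IsRun q0 δ τ bl ρ ∧
  ∀ qd ∈ ρ ([] : Pos), ∃ t, (t, [BAct.accept]) ∈ δ ∧ testHolds τ bl [] qd.1 qd.2 t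

/-- A Bottom-Up Data Automaton over the alphabet `A`: a finite internal
alphabet `B`, a finite set of states `Q`, an initial state and a finite set of
transitions. -/
structure BUDTA (A : Type) : Type 1 where
  B : Type
  Bfin : Finite B
  Q : Type
  Qfin : Finite Q
  q0 : Q
  δ : List (Trans A B Q)

/-- The automaton `M` accepts the data tree `τ`: for some internal labeling
there is an accepting run. -/
def Accepts {A D : Type} (M : BUDTA A) (τ : DataTree A D) : Prop :=
  ∃ bl : Pos → M.B, ∃ ρ : Pos → Set (M.Q × D), IsAcceptingRun M.q0 M.δ τ bl ρ

/-- Nonempty labelled paths with intermediate states in `X`. -/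
inductive Pth {S α : Type} (Δ : S → α → S → Prop) (X : Set S) : S → List α → S → Prop
  | one {p a q} : Δ p a q → Pth Δ X p [a] q
  | cons {p a m w q} : Δ p a m → m ∈ X → Pth Δ X m w q → Pth Δ X p (a :: w) q

theorem Pth.mono {S α : Type} {Δ : S → α → S → Prop} {X Y : Set S} (h : X ⊆ Y) {p w q}
    (hp : Pth Δ X p w q) : Pth Δ Y p w q := by
  induction hp with
  | one h1 => exact .one h1
  | cons h1 h2 _ ih => exact .cons h1 (h h2) ih

theorem Pth.append {S α : Type} {Δ : S → α → S → Prop} {X : Set S} {p u k v q}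
    (hp : Pth Δ X p u k) (hk : k ∈ X) (hq : Pth Δ X k v q) : Pth Δ X p (u ++ v) q := by
  induction hp with
  | one h1 => exact .cons h1 hk hq
  | cons h1 h2 _ ih => exact .cons h1 h2 (ih hk hq)

/-- The language of `Pth`. -/
def LP {S α : Type} (Δ : S → α → S → Prop) (X : Set S) (p q : S) : Language α :=
  {w | Pth Δ X p w q}

theorem mem_LP {S α : Type} {Δ : S → α → S → Prop} {X : Set S} {p q : S} {w : List α} :
    w ∈ LP Δ X p q ↔ Pth Δ X p w q := Iff.rfl

theorem LP_insert {S α : Type} (Δ : S → α → S → Prop) (X : Set S) (k p q : S) :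
    LP Δ (insert k X) p q = LP Δ X p q + LP Δ X p k * (KStar.kstar (LP Δ X k k) * LP Δ X k q) := by
  ext w
  have hm : X ⊆ insert k X := Set.subset_insert k X
  have hk : k ∈ insert k X := Set.mem_insert k X
  constructor
  · intro h
    change Pth _ _ _ _ _ at h
    induction h with
    | one h1 => exact Or.inl (Pth.one h1)
    | @cons p a m w q h1 h2 _ ih =>
      rcases h2 with rfl | h2
      · right
        refine Language.mem_mul.2 ⟨[a], Pth.one h1, w, ?_, rfl⟩
        rcases ih with ih | ih
        · exact Language.mem_mul.2 ⟨[], Language.nil_mem_kstar _, w, ih, rfl⟩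
        · obtain ⟨u, hu, v, hv, rfl⟩ := Language.mem_mul.1 ih
          obtain ⟨v1, hv1, v2, hv2, rfl⟩ := Language.mem_mul.1 hv
          refine Language.mem_mul.2 ⟨u ++ v1, ?_, v2, hv2, by simp⟩
          obtain ⟨L, rfl, hL⟩ := Language.mem_kstar.1 hv1
          exact Language.mem_kstar.2 ⟨u :: L, by simp, by
            intro y hy
            rcases List.mem_cons.1 hy with rfl | hy
            · exact hu
            · exact hL y hy⟩
      · rcases ih with ih | ih
        · exact Or.inl (Pth.cons h1 h2 ih)
        · right
          obtain ⟨u, hu, v, hv, rfl⟩ := Language.mem_mul.1 ih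
          exact Language.mem_mul.2 ⟨a :: u, Pth.cons h1 h2 hu, v, hv, by simp⟩
  · rintro (h | h)
    · exact Pth.mono hm h
    · obtain ⟨u, hu, v, hv, rfl⟩ := Language.mem_mul.1 h
      obtain ⟨v1, hv1, v2, hv2, rfl⟩ := Language.mem_mul.1 hv
      refine Pth.append (Pth.mono hm hu) hk ?_
      obtain ⟨L, rfl, hL⟩ := Language.mem_kstar.1 hv1
      clear h hv hv1
      induction L with
      | nil => simpa using Pth.mono hm hv2
      | cons y L ih =>
        simp only [List.flatten_cons, List.append_assoc]
        exact Pth.append (Pth.mono hm (hL y (by simp))) hk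
          (ih (fun z hz => hL z (by simp [hz])))

theorem regex_letters {α : Type} [Finite α] (P : α → Prop) :
    ∃ e : RegularExpression α, ∀ w, w ∈ e.matches' ↔ ∃ a, P a ∧ w = [a] := by
  suffices h : ∀ s : Set α, s.Finite → ∃ e : RegularExpression α,
      ∀ w, w ∈ e.matches' ↔ ∃ a ∈ s, w = [a] by
    exact h {a | P a} (Set.toFinite _)
  intro s hs
  induction s, hs using Set.Finite.induction_on with
  | empty => exact ⟨0, fun w => by simp⟩
  | @insert a s _ _ ih =>
    obtain ⟨e, he⟩ := ih
    refine ⟨RegularExpression.char a + e, fun w => ?_⟩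
    rw [RegularExpression.matches'_add, Language.mem_add, he]
    simp
    rfl

/-- Kleene's theorem, for nonempty words. -/
theorem kleene {S α : Type} [Finite S] [Finite α] (Δ : S → α → S → Prop) (p q : S) :
    ∃ e : RegularExpression α, ∀ w, w ∈ e.matches' ↔ Pth Δ Set.univ p w q := by
  suffices h : ∀ X : Set S, X.Finite → ∀ p q, ∃ e : RegularExpression α,
      e.matches' = LP Δ X p q by
    obtain ⟨e, he⟩ := h Set.univ Set.finite_univ p q
    exact ⟨e, fun w => by rw [he]; rfl⟩
  intro X hX
  induction X, hX using Set.Finite.induction_on with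
  | empty =>
    intro p q
    obtain ⟨e, he⟩ := regex_letters (fun a => Δ p a q)
    refine ⟨e, Set.ext fun w => (he w).trans ?_⟩
    constructor
    · rintro ⟨a, ha, rfl⟩
      exact Pth.one ha
    · intro h
      cases h with
      | one h => exact ⟨_, h, rfl⟩
      | cons _ h => exact h.elim
  | @insert k X _ _ ih =>
    intro p q
    obtain ⟨e1, h1⟩ := ih p q
    obtain ⟨e2, h2⟩ := ih p k
    obtain ⟨e3, h3⟩ := ih k k
    obtain ⟨e4, h4⟩ := ih k q
    exact ⟨e1 + e2 * (e3.star * e4), by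
      rw [LP_insert, RegularExpression.matches'_add, RegularExpression.matches'_mul,
        RegularExpression.matches'_mul, RegularExpression.matches'_star, h1, h2, h3, h4]⟩

/-- Directions of a step of a tree walking automaton. -/
inductive Dir where
  | stay | dn | up

theorem rtg_mono {α : Type} {r s : α → α → Prop} (h : ∀ a b, r a b → s a b) {a b : α}
    (hab : Relation.ReflTransGen r a b) : Relation.ReflTransGen s a b := by
  induction hab with
  | refl => exact .refl
  | tail _ h1 ih => exact ih.tail (h _ _ h1)

section Graph
variable {A D S : Type}

/-- One step of the walking automaton with local edges `E`. -/
def stepR (τ : DataTree A D) (E : Pos → Dir → S → S → Prop) (u v : Pos × S) : Prop :=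
  u.1 ∈ τ.pos ∧ v.1 ∈ τ.pos ∧
    ((v.1 = u.1 ∧ E u.1 .stay u.2 v.2) ∨ (∃ i : ℕ, v.1 = u.1 ++ [i] ∧ E u.1 .dn u.2 v.2) ∨
      (∃ i : ℕ, u.1 = v.1 ++ [i] ∧ E u.1 .up u.2 v.2))

/-- Reachability. -/
def Reach (τ : DataTree A D) (E : Pos → Dir → S → S → Prop) (x : Pos) (p : S) (y : Pos) (q : S) :
    Prop := Relation.ReflTransGen (stepR τ E) (x, p) (y, q)

/-- Reachability inside the subtree of `z`. -/
def ReachIn (τ : DataTree A D) (E : Pos → Dir → S → S → Prop) (z : Pos)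
    (x : Pos) (p : S) (y : Pos) (q : S) : Prop :=
  Relation.ReflTransGen (fun u v => stepR τ E u v ∧ z <+: u.1 ∧ z <+: v.1) (x, p) (y, q)

variable {τ : DataTree A D} {E : Pos → Dir → S → S → Prop}

theorem Reach.trans {x y z : Pos} {p q r : S} (h1 : Reach τ E x p y q) (h2 : Reach τ E y q z r) :
    Reach τ E x p z r := Relation.ReflTransGen.trans h1 h2

theorem ReachIn.trans {w x y z : Pos} {p q r : S} (h1 : ReachIn τ E w x p y q)
    (h2 : ReachIn τ E w y q z r) : ReachIn τ E w x p z r := Relation.ReflTransGen.trans h1 h2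

theorem ReachIn.toReach {z x y : Pos} {p q : S} (h : ReachIn τ E z x p y q) : Reach τ E x p y q :=
  rtg_mono (fun _ _ h => h.1) h

theorem ReachIn.weaken {z z' x y : Pos} {p q : S} (hz : z' <+: z) (h : ReachIn τ E z x p y q) :
    ReachIn τ E z' x p y q :=
  rtg_mono (fun _ _ h => ⟨h.1, hz.trans h.2.1, hz.trans h.2.2⟩) h

theorem Reach.mem {x y : Pos} {p q : S} (h : Reach τ E x p y q) (hx : x ∈ τ.pos) : y ∈ τ.pos := by
  rcases Relation.ReflTransGen.cases_tail h with h | ⟨c, _, h⟩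
  · cases h; exact hx
  · exact h.2.1

theorem reach_root {x y : Pos} {p q : S} : ReachIn τ E [] x p y q ↔ Reach τ E x p y q :=
  ⟨ReachIn.toReach, rtg_mono (fun _ _ h => ⟨h, by simp, by simp⟩)⟩

theorem not_prefix_self_append (x : Pos) (i : ℕ) : ¬ (x ++ [i] <+: x) := by
  intro h
  have := h.length_le
  simp at this

theorem prefix_child {c y : Pos} (h : c <+: y) (i : ℕ) : c <+: y ++ [i] :=
  h.trans (List.prefix_append _ _)

/-- If a step enters the subtree of `c`, it enters it at `c` from the parent. -/
theorem step_enter {z y : Pos} {i : ℕ} {u : Pos × S} {q : S} (h : stepR τ E u (y, q))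
    (hu : ¬ (z ++ [i] <+: u.1)) (hy : z ++ [i] <+: y) :
    u.1 = z ∧ y = z ++ [i] ∧ E z .dn u.2 q := by
  obtain ⟨_, _, ⟨h1, _⟩ | ⟨j, h1, h2⟩ | ⟨j, h1, _⟩⟩ := h
  · exact absurd (h1 ▸ hy) hu
  · simp only at h1 h2
    rw [h1, List.prefix_concat_iff] at hy
    rcases hy with hy | hy
    · obtain ⟨h3, h4⟩ := List.append_inj' hy rfl
      subst h3
      cases h4
      exact ⟨rfl, h1, h2⟩
    · exact absurd hy hu
  · exact absurd (h1 ▸ prefix_child hy j) hu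

/-- If a step leaves the subtree of `c`, it leaves it at `c` to the parent. -/
theorem step_leave {z : Pos} {i : ℕ} {u v : Pos × S} (h : stepR τ E u v)
    (hu : z ++ [i] <+: u.1) (hv : ¬ (z ++ [i] <+: v.1)) :
    v.1 = z ∧ u.1 = z ++ [i] ∧ E (z ++ [i]) .up u.2 v.2 := by
  obtain ⟨_, _, ⟨h1, _⟩ | ⟨j, h1, _⟩ | ⟨j, h1, h2⟩⟩ := h
  · exact absurd (h1 ▸ hu) hv
  · exact absurd (h1 ▸ prefix_child hu j) hv
  · have h3 := h1
    rw [h1, List.prefix_concat_iff] at hu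
    rcases hu with hu | hu
    · obtain ⟨h4, h5⟩ := List.append_inj' hu rfl
      rw [← hu] at h3
      rw [h3] at h2
      exact ⟨h4.symm, h3, h2⟩
    · exact absurd hu hv

theorem reach_stay {x : Pos} {p q : S} (hx : x ∈ τ.pos) (h : E x .stay p q) :
    ReachIn τ E x x p x q :=
  Relation.ReflTransGen.single ⟨⟨hx, hx, Or.inl ⟨rfl, h⟩⟩, List.prefix_rfl, List.prefix_rfl⟩

theorem reach_dn {x : Pos} {i : ℕ} {p q : S} (hx : x ++ [i] ∈ τ.pos) (h : E x .dn p q) :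
    ReachIn τ E x x p (x ++ [i]) q :=
  Relation.ReflTransGen.single ⟨⟨τ.parent_closed _ _ hx, hx, Or.inr (Or.inl ⟨i, rfl, h⟩)⟩,
    List.prefix_rfl, List.prefix_append _ _⟩

theorem reach_up {x : Pos} {i : ℕ} {p q : S} (hx : x ++ [i] ∈ τ.pos) (h : E (x ++ [i]) .up p q) :
    ReachIn τ E x (x ++ [i]) p x q :=
  Relation.ReflTransGen.single ⟨⟨hx, τ.parent_closed _ _ hx, Or.inr (Or.inr ⟨i, rfl, h⟩)⟩,
    List.prefix_append _ _, List.prefix_rfl⟩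

/-- The one-round loop relation used for the loops in the subtree of `x`. -/
def loopB (τ : DataTree A D) (E : Pos → Dir → S → S → Prop) (x : Pos) (p q : S) : Prop :=
  E x .stay p q ∨ ∃ i : ℕ, x ++ [i] ∈ τ.pos ∧ ∃ p0 q0, E x .dn p p0 ∧
    ReachIn τ E (x ++ [i]) (x ++ [i]) p0 (x ++ [i]) q0 ∧ E (x ++ [i]) .up q0 q

theorem belowLoop {x : Pos} (hx : x ∈ τ.pos) (p q : S) :
    ReachIn τ E x x p x q ↔ Relation.ReflTransGen (loopB τ E x) p q := by
  constructor
  · intro h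
    have key : ∀ v : Pos × S, Relation.ReflTransGen
        (fun u v => stepR τ E u v ∧ x <+: u.1 ∧ x <+: v.1) (x, p) v →
        (v.1 = x ∧ Relation.ReflTransGen (loopB τ E x) p v.2) ∨
        (∃ i : ℕ, x ++ [i] ∈ τ.pos ∧ x ++ [i] <+: v.1 ∧ ∃ p' p0,
          Relation.ReflTransGen (loopB τ E x) p p' ∧ E x .dn p' p0 ∧
          ReachIn τ E (x ++ [i]) (x ++ [i]) p0 v.1 v.2) := by
      intro v hv
      induction hv with
      | refl => exact Or.inl ⟨rfl, .refl⟩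
      | @tail u v _ huv ih =>
        obtain ⟨hs, hu, hv⟩ := huv
        rcases ih with ⟨h1, h2⟩ | ⟨i, hi, h1, p', p0, h2, h3, h4⟩
        · obtain ⟨m1, m2, ⟨h3, h4⟩ | ⟨j, h3, h4⟩ | ⟨j, h3, h4⟩⟩ := hs
          · left
            rw [h1] at h3 h4
            exact ⟨h3, h2.tail (Or.inl h4)⟩
          · right
            rw [h1] at h3 h4
            refine ⟨j, h3 ▸ m2, h3 ▸ List.prefix_rfl, _, _, h2, h4, ?_⟩
            rw [h3]
            exact .refl
          · exfalso
            rw [← h1, h3] at hv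
            exact not_prefix_self_append _ _ hv
        · by_cases hin : x ++ [i] <+: v.1
          · right
            exact ⟨i, hi, hin, p', p0, h2, h3, Relation.ReflTransGen.tail h4 ⟨hs, h1, hin⟩⟩
          · left
            obtain ⟨h5, h6, h7⟩ := step_leave hs h1 hin
            rw [h6] at h4
            exact ⟨h5, h2.tail (Or.inr ⟨i, hi, p0, _, h3, h4, h7⟩)⟩
    rcases key _ h with h | ⟨i, _, h, _⟩
    · exact h.2
    · exact absurd h (not_prefix_self_append _ _)
  · intro h
    induction h with
    | refl => exact .refl
    | tail _ h ih =>
      refine ih.trans ?_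
      rcases h with h | ⟨i, hi, p0, q0, h1, h2, h3⟩
      · exact reach_stay hx h
      · exact ((reach_dn hi h1).trans (h2.weaken (List.prefix_append _ _))).trans (reach_up hi h3)

/-- The one-round loop relation used for all loops at a child. -/
def loopC (τ : DataTree A D) (E : Pos → Dir → S → S → Prop) (x : Pos) (i : ℕ) (p q : S) : Prop :=
  ReachIn τ E (x ++ [i]) (x ++ [i]) p (x ++ [i]) q ∨
    ∃ p0 q0, E (x ++ [i]) .up p p0 ∧ Reach τ E x p0 x q0 ∧ E x .dn q0 q

theorem fullLoop {x : Pos} {i : ℕ} (hx : x ++ [i] ∈ τ.pos) (p q : S) :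
    Reach τ E (x ++ [i]) p (x ++ [i]) q ↔ Relation.ReflTransGen (loopC τ E x i) p q := by
  constructor
  · intro h
    have key : ∀ v : Pos × S, Relation.ReflTransGen (stepR τ E) (x ++ [i], p) v →
        (x ++ [i] <+: v.1 → ∃ p', Relation.ReflTransGen (loopC τ E x i) p p' ∧
          ReachIn τ E (x ++ [i]) (x ++ [i]) p' v.1 v.2) ∧
        (¬ x ++ [i] <+: v.1 → ∃ p' p1, Relation.ReflTransGen (loopC τ E x i) p p' ∧
          E (x ++ [i]) .up p' p1 ∧ Reach τ E x p1 v.1 v.2) := by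
      intro v hv
      induction hv with
      | refl => exact ⟨fun _ => ⟨p, .refl, .refl⟩, fun h => absurd List.prefix_rfl h⟩
      | @tail u v _ hs ih =>
        by_cases hu : x ++ [i] <+: u.1
        · obtain ⟨p', h1, h2⟩ := ih.1 hu
          refine ⟨fun hv => ⟨p', h1, Relation.ReflTransGen.tail h2 ⟨hs, hu, hv⟩⟩, fun hv => ?_⟩
          obtain ⟨h5, h6, h7⟩ := step_leave hs hu hv
          rw [h6] at h2
          refine ⟨u.2, v.2, h1.tail (Or.inl h2), h7, ?_⟩
          rw [h5]
          exact .refl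
        · obtain ⟨p', p1, h1, h2, h3⟩ := ih.2 hu
          refine ⟨fun hv => ?_, fun _ => ⟨p', p1, h1, h2, Relation.ReflTransGen.tail h3 hs⟩⟩
          obtain ⟨h5, h6, h7⟩ := step_enter hs hu hv
          rw [h5] at h3
          refine ⟨v.2, h1.tail (Or.inr ⟨p1, _, h2, h3, h7⟩), ?_⟩
          rw [h6]
          exact .refl
    obtain ⟨p', h1, h2⟩ := (key _ h).1 List.prefix_rfl
    exact h1.tail (Or.inl h2)
  · intro h
    induction h with
    | refl => exact .refl
    | tail _ h ih =>
      refine ih.trans ?_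
      rcases h with h | ⟨p0, q0, h1, h2, h3⟩
      · exact h.toReach
      · exact ((reach_up hx h1).toReach.trans h2).trans (reach_dn hx h3).toReach

theorem downStep {x z : Pos} {i : ℕ} (hz : z ++ [i] ∈ τ.pos) (hxz : x <+: z) (p q : S) :
    Reach τ E x p (z ++ [i]) q ↔ ∃ p' p'', Reach τ E x p z p' ∧ E z .dn p' p'' ∧
      Reach τ E (z ++ [i]) p'' (z ++ [i]) q := by
  constructor
  · intro h
    have key : ∀ v : Pos × S, Relation.ReflTransGen (stepR τ E) (x, p) v →
        z ++ [i] <+: v.1 → ∃ p' p'', Reach τ E x p z p' ∧ E z .dn p' p'' ∧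
          Reach τ E (z ++ [i]) p'' v.1 v.2 := by
      intro v hv
      induction hv with
      | refl => exact fun h => absurd (h.trans hxz) (not_prefix_self_append _ _)
      | @tail u v hr hs ih =>
        intro hv
        by_cases hu : z ++ [i] <+: u.1
        · obtain ⟨p', p'', h1, h2, h3⟩ := ih hu
          exact ⟨p', p'', h1, h2, Relation.ReflTransGen.tail h3 hs⟩
        · obtain ⟨h5, h6, h7⟩ := step_enter hs hu hv
          refine ⟨u.2, v.2, ?_, h7, ?_⟩
          · rw [← h5]
            exact hr
          · rw [h6]
            exact .refl
    exact key _ h List.prefix_rfl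
  · rintro ⟨p', p'', h1, h2, h3⟩
    exact (h1.trans (reach_dn hz h2).toReach).trans h3

theorem upStep {z y : Pos} {i : ℕ} (hy : ¬ z ++ [i] <+: y) {p q : S}
    (h : Reach τ E (z ++ [i]) p y q) :
    ∃ p' p1, Reach τ E (z ++ [i]) p (z ++ [i]) p' ∧ E (z ++ [i]) .up p' p1 ∧
      Reach τ E z p1 y q := by
  have key : ∀ v : Pos × S, Relation.ReflTransGen (stepR τ E) (z ++ [i], p) v →
      ¬ z ++ [i] <+: v.1 → ∃ p' p1, Reach τ E (z ++ [i]) p (z ++ [i]) p' ∧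
        E (z ++ [i]) .up p' p1 ∧ Reach τ E z p1 v.1 v.2 := by
    intro v hv
    induction hv with
    | refl => exact fun h => absurd List.prefix_rfl h
    | @tail u v hr hs ih =>
      intro hv
      by_cases hu : z ++ [i] <+: u.1
      · obtain ⟨h5, h6, h7⟩ := step_leave hs hu hv
        have hr' : Reach τ E (z ++ [i]) p u.1 u.2 := hr
        rw [h6] at hr'
        refine ⟨u.2, v.2, hr', h7, ?_⟩
        · rw [h5]
          exact .refl
      · obtain ⟨p', p1, h1, h2, h3⟩ := ih hu
        exact ⟨p', p1, h1, h2, Relation.ReflTransGen.tail h3 hs⟩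
  exact key _ h hy

theorem upStep' {z y : Pos} {i : ℕ} (hz : z ++ [i] ∈ τ.pos) {p p' p1 q : S}
    (h1 : Reach τ E (z ++ [i]) p (z ++ [i]) p') (h2 : E (z ++ [i]) .up p' p1)
    (h3 : Reach τ E z p1 y q) : Reach τ E (z ++ [i]) p y q :=
  (h1.trans (reach_up hz h2).toReach).trans h3

theorem reach_congr {E' : Pos → Dir → S → S → Prop} (h : ∀ x ∈ τ.pos, E x = E' x) :
    Reach τ E = Reach τ E' ∧ ReachIn τ E = ReachIn τ E' := by
  have : stepR τ E = stepR τ E' := by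
    funext u v
    unfold stepR
    by_cases hu : u.1 ∈ τ.pos
    · rw [h _ hu]
    · simp [hu]
  unfold Reach ReachIn
  rw [this]
  exact ⟨rfl, rfl⟩

/-- Induction from the leaves to the root. -/
theorem bottomUp (τ : DataTree A D) {P : Pos → Prop}
    (h : ∀ x ∈ τ.pos, (∀ i : ℕ, x ++ [i] ∈ τ.pos → P (x ++ [i])) → P x) : ∀ x ∈ τ.pos, P x := by
  obtain ⟨N, hN⟩ : ∃ N : ℕ, ∀ x ∈ τ.pos, x.length ≤ N :=
    ⟨τ.pos.sup List.length, fun x hx => Finset.le_sup (f := List.length) hx⟩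
  have : ∀ n : ℕ, ∀ x ∈ τ.pos, N ≤ x.length + n → P x := by
    intro n
    induction n with
    | zero =>
      intro x hx hn
      refine h x hx fun i hi => ?_
      have := hN _ hi
      simp at this
      omega
    | succ n ih =>
      intro x hx hn
      refine h x hx fun i hi => ih _ hi ?_
      simp
      omega
  exact fun x hx => this N x hx (by omega)

/-- Induction from the root to the leaves. -/
theorem topDown (τ : DataTree A D) {P : Pos → Prop} (h0 : P [])
    (h : ∀ (x : Pos) (i : ℕ), x ++ [i] ∈ τ.pos → P x → P (x ++ [i])) : ∀ x ∈ τ.pos, P x := by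
  intro x
  induction x using List.reverseRecOn with
  | nil => exact fun _ => h0
  | append_singleton x i ih => exact fun hx => h x i hx (ih (τ.parent_closed _ _ hx))

end Graph

/-- Path semantics relative to an assignment `H` of truth values to node expressions. -/
def pathSemH {A D : Type} (τ : DataTree A D) (H : Pos → NodeE A → Prop) :
    PathE A → Pos → Pos → Prop
  | .eps => fun x y => x ∈ τ.pos ∧ y = x
  | .down => fun x y => y ∈ τ.pos ∧ ∃ i : ℕ, y = x ++ [i]
  | .up => fun x y => x ∈ τ.pos ∧ ∃ i : ℕ, x = y ++ [i]
  | .testR α φ => fun x y => pathSemH τ H α x y ∧ H y φ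
  | .testL φ α => fun x y => H x φ ∧ pathSemH τ H α x y
  | .comp α β => fun x z => ∃ y, pathSemH τ H α x y ∧ pathSemH τ H β y z
  | .union α β => fun x y => pathSemH τ H α x y ∨ pathSemH τ H β x y
  | .star α => fun x y => x ∈ τ.pos ∧ Relation.ReflTransGen (pathSemH τ H α) x y

/-- Small-step semantics of path expressions, relative to the true node expressions `h`. -/
inductive Stp {A : Type} (h : NodeE A → Prop) : Dir → PathE A → PathE A → Prop
  | down : Stp h .dn .down .eps
  | up : Stp h .up .up .eps
  | testR_in {m α α' φ} : Stp h m α α' → Stp h m (.testR α φ) (.testR α' φ)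
  | testR_fin {φ} : h φ → Stp h .stay (.testR .eps φ) .eps
  | testL {φ α} : h φ → Stp h .stay (.testL φ α) α
  | comp_in {m α α' β} : Stp h m α α' → Stp h m (.comp α β) (.comp α' β)
  | comp_fin {β} : Stp h .stay (.comp .eps β) β
  | unionL {α β} : Stp h .stay (.union α β) α
  | unionR {α β} : Stp h .stay (.union α β) β
  | star_end {α} : Stp h .stay (.star α) .eps
  | star_go {α} : Stp h .stay (.star α) (.comp α (.star α))

/-- Residuals of a path expression. -/
def res {A : Type} : PathE A → Set (PathE A)
  | .eps => {.eps}
  | .down => {.down, .eps}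
  | .up => {.up, .eps}
  | .testR α φ => (fun γ => .testR γ φ) '' res α ∪ {.eps}
  | .testL φ α => {.testL φ α} ∪ res α
  | .comp α β => (fun γ => .comp γ β) '' res α ∪ res β
  | .union α β => {.union α β} ∪ (res α ∪ res β)
  | .star α => {.star α, .eps} ∪ (fun γ => .comp γ (.star α)) '' res α

mutual
  /-- All path expressions needed for the node tests of a path expression. -/
  def nestP {A : Type} : PathE A → Set (PathE A)
    | .eps => ∅
    | .down => ∅
    | .up => ∅
    | .testR α φ => nestP α ∪ allN φ
    | .testL φ α => nestP α ∪ allN φ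
    | .comp α β => nestP α ∪ nestP β
    | .union α β => nestP α ∪ nestP β
    | .star α => nestP α
  /-- All path expressions needed for a node expression. -/
  def allN {A : Type} : NodeE A → Set (PathE A)
    | .lab _ => ∅
    | .not φ => allN φ
    | .and φ ψ => allN φ ∪ allN ψ
    | .or φ ψ => allN φ ∪ allN ψ
    | .somePath α => res α ∪ nestP α
    | .eqTest α β => (res α ∪ nestP α) ∪ (res β ∪ nestP β)
    | .neqTest α β => (res α ∪ nestP α) ∪ (res β ∪ nestP β)
end

theorem self_mem_res {A : Type} : ∀ α : PathE A, α ∈ res α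
  | .eps => by simp [res]
  | .down => by simp [res]
  | .up => by simp [res]
  | .testR α φ => by simp [res, self_mem_res α]
  | .testL φ α => by simp [res]
  | .comp α β => by simp [res, self_mem_res α]
  | .union α β => by simp [res]
  | .star α => by simp [res]

theorem res_finite {A : Type} : ∀ α : PathE A, (res α).Finite
  | .eps => by simp [res]
  | .down => by simp [res]
  | .up => by simp [res]
  | .testR α φ => by simpa [res] using (res_finite α).image _
  | .testL φ α => by simpa [res] using (res_finite α)
  | .comp α β => by simpa [res] using ⟨(res_finite α).image _, res_finite β⟩
  | .union α β => by simpa [res] using ⟨(res_finite α), res_finite β⟩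
  | .star α => by simpa [res] using (res_finite α).image _

mutual
  theorem nestP_finite {A : Type} : ∀ α : PathE A, (nestP α).Finite
    | .eps => by simp [nestP]
    | .down => by simp [nestP]
    | .up => by simp [nestP]
    | .testR α φ => by simpa [nestP] using ⟨nestP_finite α, allN_finite φ⟩
    | .testL φ α => by simpa [nestP] using ⟨nestP_finite α, allN_finite φ⟩
    | .comp α β => by simpa [nestP] using ⟨nestP_finite α, nestP_finite β⟩
    | .union α β => by simpa [nestP] using ⟨nestP_finite α, nestP_finite β⟩
    | .star α => by simpa [nestP] using nestP_finite α
  theorem allN_finite {A : Type} : ∀ φ : NodeE A, (allN φ).Finite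
    | .lab _ => by simp [allN]
    | .not φ => by simpa [allN] using allN_finite φ
    | .and φ ψ => by simpa [allN] using ⟨allN_finite φ, allN_finite ψ⟩
    | .or φ ψ => by simpa [allN] using ⟨allN_finite φ, allN_finite ψ⟩
    | .somePath α => by simpa [allN] using ⟨res_finite α, nestP_finite α⟩
    | .eqTest α β => by
        simpa [allN] using ⟨⟨res_finite α, nestP_finite α⟩, ⟨res_finite β, nestP_finite β⟩⟩
    | .neqTest α β => by
        simpa [allN] using ⟨⟨res_finite α, nestP_finite α⟩, ⟨res_finite β, nestP_finite β⟩⟩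
end

/-- Closure under steps. -/
def StpClosed {A : Type} (s : Set (PathE A)) : Prop :=
  ∀ h m γ γ', Stp h m γ γ' → γ ∈ s → γ' ∈ s

theorem StpClosed.union {A : Type} {s t : Set (PathE A)} (hs : StpClosed s) (ht : StpClosed t) :
    StpClosed (s ∪ t) := by
  rintro h m γ γ' hst (hg | hg)
  · exact Or.inl (hs _ _ _ _ hst hg)
  · exact Or.inr (ht _ _ _ _ hst hg)

theorem StpClosed.empty {A : Type} : StpClosed (∅ : Set (PathE A)) := fun _ _ _ _ _ h => h.elim

theorem StpClosed.eps {A : Type} : StpClosed ({.eps} : Set (PathE A)) := by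
  rintro h m γ γ' hst rfl
  cases hst

theorem eps_mem_res {A : Type} : ∀ α : PathE A, .eps ∈ res α
  | .eps => by simp [res]
  | .down => by simp [res]
  | .up => by simp [res]
  | .testR α φ => by simp [res]
  | .testL φ α => by simp [res, eps_mem_res α]
  | .comp α β => by simp [res, eps_mem_res β]
  | .union α β => by simp [res, eps_mem_res α]
  | .star α => by simp [res]

theorem res_closed {A : Type} : ∀ α : PathE A, StpClosed (res α)
  | .eps => StpClosed.eps
  | .down => by
      rintro h m γ γ' hst (rfl | rfl) <;> cases hst
      simp [res]
  | .up => by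
      rintro h m γ γ' hst (rfl | rfl) <;> cases hst
      simp [res]
  | .testR α φ => by
      rintro h m γ γ' hst (⟨δ, hδ, rfl⟩ | rfl)
      · cases hst with
        | testR_in h1 => exact Or.inl ⟨_, res_closed α _ _ _ _ h1 hδ, rfl⟩
        | testR_fin h1 => simp [res]
      · cases hst
  | .testL φ α => by
      rintro h m γ γ' hst (rfl | hγ)
      · cases hst
        exact Or.inr (self_mem_res α)
      · exact Or.inr (res_closed α _ _ _ _ hst hγ)
  | .comp α β => by
      rintro h m γ γ' hst (⟨δ, hδ, rfl⟩ | hγ)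
      · cases hst with
        | comp_in h1 => exact Or.inl ⟨_, res_closed α _ _ _ _ h1 hδ, rfl⟩
        | comp_fin => exact Or.inr (self_mem_res β)
      · exact Or.inr (res_closed β _ _ _ _ hst hγ)
  | .union α β => by
      rintro h m γ γ' hst (rfl | hγ | hγ)
      · cases hst
        · exact Or.inr (Or.inl (self_mem_res α))
        · exact Or.inr (Or.inr (self_mem_res β))
      · exact Or.inr (Or.inl (res_closed α _ _ _ _ hst hγ))
      · exact Or.inr (Or.inr (res_closed β _ _ _ _ hst hγ))
  | .star α => by
      rintro h m γ γ' hst ((rfl | rfl) | ⟨δ, hδ, rfl⟩)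
      · cases hst
        · simp [res]
        · exact Or.inr ⟨_, self_mem_res α, rfl⟩
      · cases hst
      · cases hst with
        | comp_in h1 => exact Or.inr ⟨_, res_closed α _ _ _ _ h1 hδ, rfl⟩
        | comp_fin => simp [res]

mutual
  theorem nestP_closed {A : Type} : ∀ α : PathE A, StpClosed (nestP α)
    | .eps => StpClosed.empty
    | .down => StpClosed.empty
    | .up => StpClosed.empty
    | .testR α φ => (nestP_closed α).union (allN_closed φ)
    | .testL φ α => (nestP_closed α).union (allN_closed φ)
    | .comp α β => (nestP_closed α).union (nestP_closed β)
    | .union α β => (nestP_closed α).union (nestP_closed β)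
    | .star α => nestP_closed α
  theorem allN_closed {A : Type} : ∀ φ : NodeE A, StpClosed (allN φ)
    | .lab _ => StpClosed.empty
    | .not φ => allN_closed φ
    | .and φ ψ => (allN_closed φ).union (allN_closed ψ)
    | .or φ ψ => (allN_closed φ).union (allN_closed ψ)
    | .somePath α => (res_closed α).union (nestP_closed α)
    | .eqTest α β =>
        ((res_closed α).union (nestP_closed α)).union ((res_closed β).union (nestP_closed β))
    | .neqTest α β =>
        ((res_closed α).union (nestP_closed α)).union ((res_closed β).union (nestP_closed β))
end

section Op
variable {A D : Type} {τ : DataTree A D} {H : Pos → NodeE A → Prop}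

theorem pathSemH_mem : ∀ (α : PathE A) (x y : Pos), pathSemH τ H α x y → x ∈ τ.pos ∧ y ∈ τ.pos
  | .eps, x, y, h => by obtain ⟨h1, rfl⟩ := h; exact ⟨h1, h1⟩
  | .down, x, y, h => by obtain ⟨h1, i, rfl⟩ := h; exact ⟨τ.parent_closed _ _ h1, h1⟩
  | .up, x, y, h => by obtain ⟨h1, i, rfl⟩ := h; exact ⟨h1, τ.parent_closed _ _ h1⟩
  | .testR α φ, x, y, h => pathSemH_mem α x y h.1
  | .testL φ α, x, y, h => pathSemH_mem α x y h.2
  | .comp α β, x, y, h => by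
      obtain ⟨z, h1, h2⟩ := h
      exact ⟨(pathSemH_mem α _ _ h1).1, (pathSemH_mem β _ _ h2).2⟩
  | .union α β, x, y, h => by
      rcases h with h | h
      · exact pathSemH_mem α _ _ h
      · exact pathSemH_mem β _ _ h
  | .star α, x, y, h => by
      obtain ⟨h1, h2⟩ := h
      refine ⟨h1, ?_⟩
      rcases Relation.ReflTransGen.cases_tail h2 with rfl | ⟨c, _, h⟩
      · exact h1
      · exact (pathSemH_mem α _ _ h).2

/-- Edges of the path expression automaton. -/
def opE (H : Pos → NodeE A → Prop) : Pos → Dir → PathE A → PathE A → Prop :=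
  fun x m => Stp (H x) m

theorem lift_ctx (C : PathE A → PathE A)
    (hC : ∀ h m γ γ', Stp h m γ γ' → Stp h m (C γ) (C γ')) {x y : Pos} {γ γ' : PathE A}
    (h : Reach τ (opE H) x γ y γ') : Reach τ (opE H) x (C γ) y (C γ') := by
  have := Relation.ReflTransGen.lift (p := stepR τ (opE H)) (fun u : Pos × PathE A => (u.1, C u.2))
    (fun u v (huv : stepR τ (opE H) u v) => by
      obtain ⟨m1, m2, ⟨h1, h2⟩ | ⟨i, h1, h2⟩ | ⟨i, h1, h2⟩⟩ := huv
      · exact ⟨m1, m2, Or.inl ⟨h1, hC _ _ _ _ h2⟩⟩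
      · exact ⟨m1, m2, Or.inr (Or.inl ⟨i, h1, hC _ _ _ _ h2⟩)⟩
      · exact ⟨m1, m2, Or.inr (Or.inr ⟨i, h1, hC _ _ _ _ h2⟩)⟩) _ _ h
  exact this

theorem op_stay {x : Pos} {γ γ' : PathE A} (hx : x ∈ τ.pos) (h : Stp (H x) .stay γ γ') :
    Reach τ (opE H) x γ x γ' := (reach_stay (E := opE H) hx h).toReach

theorem op_complete : ∀ (α : PathE A) (x y : Pos), pathSemH τ H α x y →
    Reach τ (opE H) x α y .eps
  | .eps, x, y, h => by obtain ⟨h1, rfl⟩ := h; exact .refl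
  | .down, x, y, h => by
      obtain ⟨h1, i, rfl⟩ := h
      exact (reach_dn (E := opE H) h1 Stp.down).toReach
  | .up, x, y, h => by
      obtain ⟨h1, i, rfl⟩ := h
      exact (reach_up (E := opE H) h1 Stp.up).toReach
  | .testR α φ, x, y, h =>
      (lift_ctx (fun γ => .testR γ φ) (fun _ _ _ _ => Stp.testR_in) (op_complete α _ _ h.1)).trans
        (op_stay (pathSemH_mem _ _ _ h.1).2 (Stp.testR_fin h.2))
  | .testL φ α, x, y, h =>
      (op_stay (pathSemH_mem _ _ _ h.2).1 (Stp.testL h.1)).trans (op_complete α _ _ h.2)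
  | .comp α β, x, y, h => by
      obtain ⟨z, h1, h2⟩ := h
      exact ((lift_ctx (fun γ => .comp γ β) (fun _ _ _ _ => Stp.comp_in)
        (op_complete α _ _ h1)).trans (op_stay (pathSemH_mem _ _ _ h1).2 Stp.comp_fin)).trans
        (op_complete β _ _ h2)
  | .union α β, x, y, h => by
      have hx := (pathSemH_mem _ _ _ h).1
      rcases h with h | h
      · exact (op_stay hx Stp.unionL).trans (op_complete α _ _ h)
      · exact (op_stay hx Stp.unionR).trans (op_complete β _ _ h)
  | .star α, x, y, h => by
      obtain ⟨h1, h2⟩ := h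
      have ih := op_complete α
      induction h2 using Relation.ReflTransGen.head_induction_on with
      | refl => exact op_stay h1 Stp.star_end
      | head h3 _ ih2 =>
        exact (((op_stay h1 Stp.star_go).trans
          (lift_ctx (fun γ => .comp γ (.star α)) (fun _ _ _ _ => Stp.comp_in) (ih _ _ h3))).trans
          (op_stay (pathSemH_mem _ _ _ h3).2 Stp.comp_fin)).trans (ih2 (pathSemH_mem _ _ _ h3).2)

/-- The move associated with a direction. -/
def mv : Dir → Pos → Pos → Prop
  | .stay => fun x y => y = x
  | .dn => fun x y => ∃ i : ℕ, y = x ++ [i]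
  | .up => fun x y => ∃ i : ℕ, x = y ++ [i]

theorem op_back {x x' : Pos} (hx : x ∈ τ.pos) (hx' : x' ∈ τ.pos) {m : Dir} {γ γ' : PathE A}
    (h : Stp (H x) m γ γ') (hm : mv m x x') : ∀ y, pathSemH τ H γ' x' y → pathSemH τ H γ x y := by
  induction h with
  | down =>
    rintro y ⟨_, rfl⟩
    exact ⟨hx', hm⟩
  | up =>
    rintro y ⟨_, rfl⟩
    exact ⟨hx, hm⟩
  | testR_in _ ih =>
    rintro y ⟨h1, h2⟩
    exact ⟨ih hm _ h1, h2⟩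
  | testR_fin h =>
    cases hm
    rintro y ⟨_, rfl⟩
    exact ⟨⟨hx, rfl⟩, h⟩
  | testL h =>
    cases hm
    intro y h1
    exact ⟨h, h1⟩
  | comp_in _ ih =>
    rintro y ⟨z, h1, h2⟩
    exact ⟨z, ih hm _ h1, h2⟩
  | comp_fin =>
    cases hm
    intro y h1
    exact ⟨x, ⟨hx, rfl⟩, h1⟩
  | unionL =>
    cases hm
    intro y h1
    exact Or.inl h1
  | unionR =>
    cases hm
    intro y h1
    exact Or.inr h1
  | star_end =>
    cases hm
    rintro y ⟨_, rfl⟩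
    exact ⟨hx, .refl⟩
  | star_go =>
    cases hm
    rintro y ⟨z, h1, h2⟩
    exact ⟨hx, h2.2.head h1⟩

theorem stepR_mv {S : Type} {E : Pos → Dir → S → S → Prop} {u v : Pos × S} :
    stepR τ E u v ↔ u.1 ∈ τ.pos ∧ v.1 ∈ τ.pos ∧ ∃ m, mv m u.1 v.1 ∧ E u.1 m u.2 v.2 := by
  constructor
  · rintro ⟨m1, m2, ⟨h1, h2⟩ | ⟨i, h1, h2⟩ | ⟨i, h1, h2⟩⟩
    · exact ⟨m1, m2, .stay, h1, h2⟩
    · exact ⟨m1, m2, .dn, ⟨i, h1⟩, h2⟩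
    · exact ⟨m1, m2, .up, ⟨i, h1⟩, h2⟩
  · rintro ⟨m1, m2, m, h1, h2⟩
    refine ⟨m1, m2, ?_⟩
    cases m with
    | stay => exact Or.inl ⟨h1, h2⟩
    | dn => obtain ⟨i, h1⟩ := h1; exact Or.inr (Or.inl ⟨i, h1, h2⟩)
    | up => obtain ⟨i, h1⟩ := h1; exact Or.inr (Or.inr ⟨i, h1, h2⟩)

theorem op_sound {x y : Pos} {α : PathE A} (hx : x ∈ τ.pos) (h : Reach τ (opE H) x α y .eps) :
    pathSemH τ H α x y := by
  have key : ∀ u : Pos × PathE A, Relation.ReflTransGen (stepR τ (opE H)) u (y, .eps) →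
      u.1 ∈ τ.pos → pathSemH τ H u.2 u.1 y := by
    intro u hu
    induction hu using Relation.ReflTransGen.head_induction_on with
    | refl => exact fun h => ⟨h, rfl⟩
    | head h1 _ ih =>
      intro h2
      obtain ⟨m1, m2, m, h3, h4⟩ := stepR_mv.1 h1
      exact op_back m1 m2 h4 h3 _ (ih m2)
  exact key _ h hx

theorem op_iff {x y : Pos} {α : PathE A} (hx : x ∈ τ.pos) :
    pathSemH τ H α x y ↔ Reach τ (opE H) x α y .eps := ⟨op_complete α x y, op_sound hx⟩

/-- Restriction to a set of path expressions. -/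
def opS (s : Set (PathE A)) (h : NodeE A → Prop) (m : Dir) (p q : s) : Prop := Stp h m p.1 q.1

theorem opS_iff {s : Set (PathE A)} (hs : StpClosed s) {x y : Pos} (p q : s) :
    Reach τ (fun x => opS s (H x)) x p y q ↔ Reach τ (opE H) x p.1 y q.1 := by
  constructor
  · intro h
    exact Relation.ReflTransGen.lift (p := stepR τ (opE H)) (fun u : Pos × s => (u.1, u.2.1))
      (fun u v huv => huv) _ _ h
  · intro h
    have key : ∀ v : Pos × PathE A, Relation.ReflTransGen (stepR τ (opE H)) (x, p.1) v →
        ∃ hv : v.2 ∈ s, Reach τ (fun x => opS s (H x)) x p v.1 ⟨v.2, hv⟩ := by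
      intro v hv
      induction hv with
      | refl => exact ⟨p.2, .refl⟩
      | @tail u v _ huv ih =>
        obtain ⟨hu, ih⟩ := ih
        have hv : v.2 ∈ s := by
          obtain ⟨m1, m2, m, h3, h4⟩ := stepR_mv.1 huv
          exact hs _ _ _ _ h4 hu
        exact ⟨hv, Relation.ReflTransGen.tail ih huv⟩
    obtain ⟨hv, h⟩ := key _ h
    exact h

end Op

/-- `sat true` is equality, `sat false` is disequality. -/
def sat {D : Type} (r : Bool) (d d' : D) : Prop := r = true ↔ d = d'

theorem sat_symm {D : Type} {r : Bool} {d d' : D} (h : sat r d d') : sat r d' d :=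
  h.trans eq_comm

theorem sat_true {D : Type} {d d' : D} : sat true d d' ↔ d = d' := by simp [sat]

theorem sat_false {D : Type} {d d' : D} : sat false d d' ↔ d ≠ d' := by simp [sat]

/-- The data test relation. -/
def trueW {A D S : Type} (τ : DataTree A D) (E : Pos → Dir → S → S → Prop) (e : S)
    (x : Pos) (p q : S) (r : Bool) : Prop :=
  ∃ y z, Reach τ E x p y e ∧ Reach τ E x q z e ∧ sat r (τ.data y) (τ.data z)

/-- Local evaluation of node expressions. -/
def evalN {A : Type} (s : Set (PathE A)) (a : A) (W : s → s → Bool → Prop) : NodeE A → Prop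
  | .lab a' => a = a'
  | .not φ => ¬ evalN s a W φ
  | .and φ ψ => evalN s a W φ ∧ evalN s a W ψ
  | .or φ ψ => evalN s a W φ ∨ evalN s a W ψ
  | .somePath α => ∃ h, W ⟨α, h⟩ ⟨α, h⟩ true
  | .eqTest α β => ∃ h h', W ⟨α, h⟩ ⟨β, h'⟩ true
  | .neqTest α β => ∃ h h', W ⟨α, h⟩ ⟨β, h'⟩ false

section Eval
variable {A D : Type} {τ : DataTree A D} {H : Pos → NodeE A → Prop} {s : Set (PathE A)}
  {he : .eps ∈ s} {W : Pos → s → s → Bool → Prop}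

theorem star_congr_pos {R R' : Pos → Pos → Prop} (h : ∀ x y, R x y ↔ R' x y) (x y : Pos) :
    Relation.ReflTransGen R x y ↔ Relation.ReflTransGen R' x y :=
  ⟨rtg_mono fun a b => (h a b).1, rtg_mono fun a b => (h a b).2⟩

mutual
  theorem evalP_iff (hs : StpClosed s)
      (hW : ∀ x ∈ τ.pos, ∀ p q r, W x p q r ↔ trueW τ (fun x => opS s (H x)) ⟨.eps, he⟩ x p q r)
      (hH : ∀ x ∈ τ.pos, ∀ φ, allN φ ⊆ s → (evalN s (τ.label x) (W x) φ ↔ nodeSem τ φ x) →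
        (H x φ ↔ nodeSem τ φ x)) :
      ∀ α : PathE A, nestP α ⊆ s → ∀ x y, pathSemH τ H α x y ↔ pathSem τ α x y
    | .eps, _, x, y => by simp only [pathSemH, pathSem]
    | .down, _, x, y => by simp only [pathSemH, pathSem]
    | .up, _, x, y => by simp only [pathSemH, pathSem]
    | .testR α φ, hα, x, y => by
        simp only [nestP, Set.union_subset_iff] at hα
        have h1 := evalP_iff hs hW hH α hα.1 x y
        have h2 := evalN_iff hs hW hH φ hα.2 y
        simp only [pathSemH, pathSem]
        rw [← h1]
        refine and_congr_right fun h3 => ?_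
        have hy := (pathSemH_mem _ _ _ h3).2
        exact hH y hy φ hα.2 (h2 hy)
    | .testL φ α, hα, x, y => by
        simp only [nestP, Set.union_subset_iff] at hα
        have h1 := evalP_iff hs hW hH α hα.1 x y
        have h2 := evalN_iff hs hW hH φ hα.2 x
        simp only [pathSemH, pathSem]
        rw [← h1]
        refine and_congr_left fun h3 => ?_
        have hy := (pathSemH_mem _ _ _ h3).1
        exact hH x hy φ hα.2 (h2 hy)
    | .comp α β, hα, x, y => by
        simp only [nestP, Set.union_subset_iff] at hα
        have h1 := evalP_iff hs hW hH α hα.1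
        have h2 := evalP_iff hs hW hH β hα.2
        simp only [pathSemH, pathSem, h1, h2]
    | .union α β, hα, x, y => by
        simp only [nestP, Set.union_subset_iff] at hα
        have h1 := evalP_iff hs hW hH α hα.1
        have h2 := evalP_iff hs hW hH β hα.2
        simp only [pathSemH, pathSem, h1, h2]
    | .star α, hα, x, y => by
        simp only [nestP] at hα
        have h1 := evalP_iff hs hW hH α hα
        simp only [pathSemH, pathSem]
        rw [star_congr_pos h1]
  theorem evalN_iff (hs : StpClosed s)
      (hW : ∀ x ∈ τ.pos, ∀ p q r, W x p q r ↔ trueW τ (fun x => opS s (H x)) ⟨.eps, he⟩ x p q r)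
      (hH : ∀ x ∈ τ.pos, ∀ φ, allN φ ⊆ s → (evalN s (τ.label x) (W x) φ ↔ nodeSem τ φ x) →
        (H x φ ↔ nodeSem τ φ x)) :
      ∀ φ : NodeE A, allN φ ⊆ s → ∀ x ∈ τ.pos,
        (evalN s (τ.label x) (W x) φ ↔ nodeSem τ φ x)
    | .lab a, _, x, hx => by simp [evalN, nodeSem, hx]
    | .not φ, hφ, x, hx => by
        simp only [allN] at hφ
        simp [evalN, nodeSem, hx, evalN_iff hs hW hH φ hφ x hx]
    | .and φ ψ, hφ, x, hx => by
        simp only [allN, Set.union_subset_iff] at hφ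
        simp [evalN, nodeSem, evalN_iff hs hW hH φ hφ.1 x hx, evalN_iff hs hW hH ψ hφ.2 x hx]
    | .or φ ψ, hφ, x, hx => by
        simp only [allN, Set.union_subset_iff] at hφ
        simp [evalN, nodeSem, evalN_iff hs hW hH φ hφ.1 x hx, evalN_iff hs hW hH ψ hφ.2 x hx]
    | .somePath α, hφ, x, hx => by
        simp only [allN, Set.union_subset_iff] at hφ
        have h1 := evalP_iff hs hW hH α hφ.2 x
        have m1 : α ∈ s := hφ.1 (self_mem_res α)
        simp only [evalN, nodeSem, hW x hx, trueW, opS_iff hs, ← op_iff hx, h1, m1,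
          exists_true_left, sat_true]
        exact ⟨fun ⟨y, z, h, _, _⟩ => ⟨y, h⟩, fun ⟨y, h⟩ => ⟨y, y, h, h, rfl⟩⟩
    | .eqTest α β, hφ, x, hx => by
        simp only [allN, Set.union_subset_iff] at hφ
        have h1 := evalP_iff hs hW hH α hφ.1.2 x
        have h2 := evalP_iff hs hW hH β hφ.2.2 x
        have m1 : α ∈ s := hφ.1.1 (self_mem_res α)
        have m2 : β ∈ s := hφ.2.1 (self_mem_res β)
        simp only [evalN, nodeSem, hW x hx, trueW, opS_iff hs, ← op_iff hx, h1, h2, m1, m2,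
          exists_true_left, sat_true]
    | .neqTest α β, hφ, x, hx => by
        simp only [allN, Set.union_subset_iff] at hφ
        have h1 := evalP_iff hs hW hH α hφ.1.2 x
        have h2 := evalP_iff hs hW hH β hφ.2.2 x
        have m1 : α ∈ s := hφ.1.1 (self_mem_res α)
        have m2 : β ∈ s := hφ.2.1 (self_mem_res β)
        simp only [evalN, nodeSem, hW x hx, trueW, opS_iff hs, ← op_iff hx, h1, h2, m1, m2,
          exists_true_left, sat_false]
end

end Eval

theorem exists_delta {A B Q J I : Type} [Finite I] [Finite J] (tests : I → BTest A B Q)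
    (acts : J → List (BAct Q)) (R : (I → Prop) → J → Prop) :
    ∃ δ : List (Trans A B Q), ∀ (D : Type) (τ : DataTree A D) (bl : Pos → B) (x : Pos) (q : Q)
      (d : D) (P : List (BAct Q) → Prop),
      (∃ tr ∈ δ, testHolds τ bl x q d tr.1 ∧ P tr.2) ↔
        ∃ j, R (fun i => basicHolds τ bl x q d (tests i)) j ∧ P (acts j) := by
  classical
  have := Fintype.ofFinite I
  have := Fintype.ofFinite J
  refine ⟨((Finset.univ : Finset ((I → Bool) × J)).filter
    (fun vj => R (fun i => vj.1 i = true) vj.2)).toList.map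
      (fun vj => ((Finset.univ : Finset I).toList.map (fun i => (!vj.1 i, tests i)), acts vj.2)),
      ?_⟩
  intro D τ bl x q d P
  constructor
  · rintro ⟨tr, htr, h1, h2⟩
    simp only [List.mem_map, Finset.mem_toList, Finset.mem_filter, Finset.mem_univ, true_and] at htr
    obtain ⟨⟨v, j⟩, hR, rfl⟩ := htr
    refine ⟨j, ?_, h2⟩
    have : (fun i => basicHolds τ bl x q d (tests i)) = fun i => v i = true := by
      funext i
      have := h1 (!v i, tests i) (List.mem_map.2 ⟨i, by simp, rfl⟩)
      simpa using this
    rw [this]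
    exact hR
  · rintro ⟨j, hR, hP⟩
    refine ⟨_, List.mem_map.2 ⟨(fun i => decide (basicHolds τ bl x q d (tests i)), j), ?_, rfl⟩,
      ?_, hP⟩
    · simpa using hR
    · intro nt hnt
      simp only [List.mem_map, Finset.mem_toList, Finset.mem_univ, true_and] at hnt
      obtain ⟨i, rfl⟩ := hnt
      simp

/-- Core information attached to a node. -/
structure Core (A S : Type) where
  lab : A
  BL : S → S → Prop
  L : S → S → Prop
  W : S → S → Bool → Prop

instance {A S : Type} [Finite A] [Finite S] : Finite (Core A S) :=
  Finite.of_injective (fun c : Core A S => (c.lab, c.BL, c.L, c.W)) (by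
    rintro ⟨_, _, _, _⟩ ⟨_, _, _, _⟩ h
    simpa using h)

/-- Claims about a datum. -/
abbrev Cl (S : Type) : Type := S → Bool → Prop

section Auto
variable {A D S : Type} (edge : Core A S → Dir → S → S → Prop) (e : S) (ok : Core A S → Prop)

/-- Going up to the parent. -/
def coreU (c : Core A S) (p p1 : S) : Prop := ∃ p0, c.L p p0 ∧ edge c .up p0 p1

/-- Claims about the datum of the current node. -/
def coreV (c : Core A S) (Vs : Cl S) (p : S) (r : Bool) : Prop :=
  (r = true ∧ c.L p e) ∨ ∃ p1, coreU edge c p p1 ∧ Vs p1 r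

/-- The condition checked by every thread. -/
structure RelC (q : Option (Cl S)) (a : A) (b : Core A S × Core A S) (rt lf : Prop)
    (dn : S → Bool → Prop) (ch : Core A S × Core A S → Prop) (Vn Vs : Cl S) (G : Set (Cl S)) :
    Prop where
  lab : b.1.lab = a
  par : ∀ c, ch c → c.2 = b.1
  bl : ∀ p q, b.1.BL p q ↔ Relation.ReflTransGen (fun p q => edge b.1 .stay p q ∨
    ∃ c, ch c ∧ ∃ p0 q0, edge b.1 .dn p p0 ∧ c.1.BL p0 q0 ∧ edge c.1 .up q0 q) p q
  l : ∀ c, ch c → ∀ p q, c.1.L p q ↔ Relation.ReflTransGen (fun p q => c.1.BL p q ∨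
    ∃ p0 q0, edge c.1 .up p p0 ∧ b.1.L p0 q0 ∧ edge b.1 .dn q0 q) p q
  w : ∀ c, ch c → ∀ p q p1 q1 r, coreU edge c.1 p p1 → coreU edge c.1 q q1 → b.1.W p1 q1 r →
    c.1.W p q r
  rootL : rt → ∀ p q, b.1.L p q ↔ b.1.BL p q
  rootOk : rt → ok b.1
  chk : ∀ V, q = some V → ∀ p q r, V p true → V q r → b.1.W p q r ∧ b.1.W q p r
  claim : ∀ V, q = some V → ∀ p r, V p r ↔ dn p r ∨ ∃ p1, coreU edge b.1 p p1 ∧ Vn p1 r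
  own : ∀ p q r, coreV edge e b.1 Vs p true → coreV edge e b.1 Vs q r →
    b.1.W p q r ∧ b.1.W q p r
  leafOb : lf → ∀ p q r, b.1.W p q r →
    (coreV edge e b.1 Vs p true ∧ coreV edge e b.1 Vs q r) ∨
    (coreV edge e b.1 Vs q true ∧ coreV edge e b.1 Vs p r) ∨
    ∃ V ∈ G, ∃ p1 q1, coreU edge b.1 p p1 ∧ coreU edge b.1 q q1 ∧ V p1 true ∧ V q1 r
  parOb : ¬ rt → ∀ p q r, b.2.W p q r → ∃ V ∈ G, V p true ∧ V q r

/-- No claims. -/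
def noCl : Cl S := fun _ _ => False

/-- The transition relation of the automaton. -/
def Rel (q : Option (Cl S)) (a : A) (b : Core A S × Core A S) (rt lf : Prop)
    (dn : S → Bool → Prop) (ch : Core A S × Core A S → Prop)
    (j : Option (Cl S × Cl S × Set (Cl S))) : Prop :=
  (j = none ∧ rt ∧ RelC edge e ok q a b rt lf dn ch noCl noCl ∅) ∨
  (∃ Vn Vs G, j = some (Vn, Vs, G) ∧ ¬ rt ∧ RelC edge e ok q a b rt lf dn ch Vn Vs G)

open Classical in
/-- Actions. -/
noncomputable def acts [Finite S] : Option (Cl S × Cl S × Set (Cl S)) → List (BAct (Option (Cl S)))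
  | none => [.accept]
  | some (Vn, Vs, G) => .keep (some Vn) :: .store (some Vs) ::
      (Set.toFinite G).toFinset.toList.map (fun V => .guess (some V))

/-- The automaton for downward paths. -/
def dnDelta : Option S → A × (Core A S × Core A S) → Option S → Prop
  | some p, l, some p1 => ∃ p0, l.2.1.L p p0 ∧ edge l.2.1 .dn p0 p1
  | some p, l, none => l.2.1.L p e
  | none, _, _ => False

/-- Downward data test. -/
def dnT (τ : DataTree A D) (bl : Pos → Core A S × Core A S) (x : Pos) (d : D) (p : S) (r : Bool) :
    Prop :=
  ∃ l y, IsDownPath τ x l ∧ l.getLast? = some y ∧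
    Pth (dnDelta edge e) Set.univ (some p) (l.map fun z => (τ.label z, bl z)) none ∧
    sat r (τ.data y) d

/-- Child label test. -/
def chT {B : Type} (τ : DataTree A D) (bl : Pos → B) (x : Pos) (b : B) : Prop :=
  ∃ i : ℕ, x ++ [i] ∈ τ.pos ∧ bl (x ++ [i]) = b

theorem isDownPath_one {τ : DataTree A D} {x y : Pos} :
    IsDownPath τ x [y] ↔ y = x ∧ x ∈ τ.pos := by
  simp only [IsDownPath, List.Chain']
  constructor
  · rintro ⟨_, h1, h2, _⟩
    simp at h1 h2
    subst h1
    exact ⟨rfl, h2⟩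
  · rintro ⟨rfl, h⟩
    simp [h]

theorem isDownPath_cons {τ : DataTree A D} {x y z : Pos} {l : List Pos} :
    IsDownPath τ x (y :: z :: l) ↔ y = x ∧ x ∈ τ.pos ∧ (∃ i : ℕ, z = x ++ [i]) ∧
      IsDownPath τ z (z :: l) := by
  simp only [IsDownPath, List.Chain']
  constructor
  · rintro ⟨_, h1, h2, h3⟩
    simp at h1
    subst h1
    rw [List.isChain_cons_cons] at h3
    exact ⟨rfl, h2 _ (by simp), h3.1, by simp, by simp, fun w hw => h2 w (by simp_all), h3.2⟩
  · rintro ⟨rfl, h, h1, _, _, h2, h3⟩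
    refine ⟨by simp, by simp, ?_, ?_⟩
    · intro w hw
      rcases List.mem_cons.1 hw with rfl | hw
      · exact h
      · exact h2 w hw
    · rw [List.isChain_cons_cons]
      exact ⟨h1, h3⟩

/-- The index type of basic tests. -/
abbrev TI (A S : Type) : Type :=
  Option (Cl S) ⊕ A ⊕ (Core A S × Core A S) ⊕ Bool ⊕ (Bool × S) ⊕ (Bool × (Core A S × Core A S))

/-- Data test with a regular expression. -/
def dtest {B Q : Type} (r : Bool) (e : RegularExpression (A × B)) : BTest A B Q :=
  match r with
  | true => .deq e
  | false => .dneq e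

theorem dtest_holds {B Q : Type} {τ : DataTree A D} {bl : Pos → B} {x : Pos} {q : Q} {d : D}
    {r : Bool} {e : RegularExpression (A × B)} :
    basicHolds τ bl x q d (dtest r e) ↔ ∃ p y, IsDownPath τ x p ∧ p.getLast? = some y ∧
      (p.map fun z => (τ.label z, bl z)) ∈ e.matches' ∧ sat r (τ.data y) d := by
  cases r <;> simp [dtest, basicHolds, sat]

/-- The basic tests. -/
def tst (e1 : S → RegularExpression (A × (Core A S × Core A S)))
    (e2 : Core A S × Core A S → RegularExpression (A × (Core A S × Core A S))) :
    TI A S → BTest A (Core A S × Core A S) (Option (Cl S))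
  | .inl q => .state q
  | .inr (.inl a) => .lab a
  | .inr (.inr (.inl b)) => .ilab b
  | .inr (.inr (.inr (.inl true))) => .root
  | .inr (.inr (.inr (.inl false))) => .leaf
  | .inr (.inr (.inr (.inr (.inl (r, p))))) => dtest r (e1 p)
  | .inr (.inr (.inr (.inr (.inr (r, b))))) => dtest r (e2 b)

theorem regex_child {α : Type} [Finite α] (P : α → Prop) :
    ∃ e : RegularExpression α, ∀ w, w ∈ e.matches' ↔ ∃ a b, P b ∧ w = [a, b] := by
  obtain ⟨e1, h1⟩ := regex_letters (fun _ : α => True)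
  obtain ⟨e2, h2⟩ := regex_letters P
  refine ⟨e1 * e2, fun w => ?_⟩
  rw [RegularExpression.matches'_mul, Language.mem_mul]
  simp only [h1, h2]
  constructor
  · rintro ⟨_, ⟨a, _, rfl⟩, _, ⟨b, hb, rfl⟩, rfl⟩
    exact ⟨a, b, hb, rfl⟩
  · rintro ⟨a, b, hb, rfl⟩
    exact ⟨[a], ⟨a, trivial, rfl⟩, [b], ⟨b, hb, rfl⟩, rfl⟩

theorem exists_auto [Finite A] [Finite S] :
    ∃ δ : List (Trans A (Core A S × Core A S) (Option (Cl S))), ∀ (D : Type) (τ : DataTree A D)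
      (bl : Pos → Core A S × Core A S) (x : Pos) (_ : x ∈ τ.pos) (q : Option (Cl S))
      (d : D) (P : List (BAct (Option (Cl S))) → Prop),
      (∃ tr ∈ δ, testHolds τ bl x q d tr.1 ∧ P tr.2) ↔
        ∃ j, Rel edge e ok q (τ.label x) (bl x) (x = []) (IsLeaf τ x) (dnT edge e τ bl x d)
          (chT τ bl x) j ∧ P (acts j) := by
  choose e1 he1 using fun p : S =>
    kleene (α := A × (Core A S × Core A S)) (dnDelta edge e) (some p) none
  choose e2 he2 using fun b : Core A S × Core A S =>
    regex_child (α := A × (Core A S × Core A S)) (fun l => l.2 = b)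
  obtain ⟨δ, hδ⟩ := exists_delta (tst e1 e2) acts (fun v j => ∃ q a b, v (.inl q) ∧
    v (.inr (.inl a)) ∧ v (.inr (.inr (.inl b))) ∧
    Rel edge e ok q a b (v (.inr (.inr (.inr (.inl true))))) (v (.inr (.inr (.inr (.inl false)))))
      (fun p r => v (.inr (.inr (.inr (.inr (.inl (r, p)))))))
      (fun b => v (.inr (.inr (.inr (.inr (.inr (true, b)))))) ∨
        v (.inr (.inr (.inr (.inr (.inr (false, b))))))) j)
  refine ⟨δ, fun D τ bl x hx q d P => (hδ D τ bl x q d P).trans ?_⟩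
  refine exists_congr fun j => and_congr_left fun _ => ?_
  have hdn : (fun p r => basicHolds τ bl x q d (tst e1 e2 (.inr (.inr (.inr (.inr (.inl (r, p)))))))) =
      dnT edge e τ bl x d := by
    funext p r
    simp only [tst, dtest_holds, he1, dnT]
  have hch : (fun b => basicHolds τ bl x q d (tst e1 e2 (.inr (.inr (.inr (.inr (.inr (true, b))))))) ∨
      basicHolds τ bl x q d (tst e1 e2 (.inr (.inr (.inr (.inr (.inr (false, b)))))))) =
      chT τ bl x := by
    funext b
    simp only [tst, dtest_holds, he2, chT, eq_iff_iff]
    constructor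
    · have aux : ∀ (l : List Pos), IsDownPath τ x l → (∃ a b', b'.2 = b ∧
          (l.map fun z => (τ.label z, bl z)) = [a, b']) →
          ∃ i : ℕ, x ++ [i] ∈ τ.pos ∧ bl (x ++ [i]) = b := by
        rintro l hl ⟨a, b', hb, hm⟩
        match l, hl, hm with
        | [y, z], hl, hm =>
          obtain ⟨rfl, _, ⟨i, rfl⟩, h2⟩ := isDownPath_cons.1 hl
          simp only [List.map_cons, List.map_nil, List.cons.injEq, and_true] at hm
          exact ⟨i, (isDownPath_one.1 h2).2, by rw [← hb, ← hm.2]⟩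
      rintro (⟨l, y, hl, _, h, _⟩ | ⟨l, y, hl, _, h, _⟩) <;> exact aux l hl h
    · rintro ⟨i, hi, hb⟩
      have h1 : IsDownPath τ x [x, x ++ [i]] :=
        isDownPath_cons.2 ⟨rfl, hx, ⟨i, rfl⟩, isDownPath_one.2 ⟨rfl, hi⟩⟩
      by_cases h : τ.data (x ++ [i]) = d
      · exact Or.inl ⟨_, x ++ [i], h1, by simp, ⟨_, _, hb, rfl⟩, sat_true.2 h⟩
      · exact Or.inr ⟨_, x ++ [i], h1, by simp, ⟨_, _, hb, rfl⟩, sat_false.2 h⟩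
  rw [hdn, hch]
  simp only [tst, basicHolds]
  constructor
  · rintro ⟨q', a, b, rfl, rfl, rfl, h⟩
    exact h
  · intro h
    exact ⟨_, _, _, rfl, rfl, rfl, h⟩

/-- What every thread of an accepting run satisfies. -/
def ThreadOK (τ : DataTree A D) (bl : Pos → Core A S × Core A S)
    (ρ : Pos → Set (Option (Cl S) × D)) (x : Pos) (q : Option (Cl S)) (d : D) : Prop :=
  ∃ Vn Vs G, RelC edge e ok q (τ.label x) (bl x) (x = []) (IsLeaf τ x) (dnT edge e τ bl x d)
      (chT τ bl x) Vn Vs G ∧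
    ((x = [] ∧ Vn = noCl ∧ Vs = noCl ∧ G = ∅) ∨
      ∃ (z : Pos) (i : ℕ), x = z ++ [i] ∧ (some Vn, d) ∈ ρ z ∧ (some Vs, τ.data x) ∈ ρ z ∧
        ∀ V ∈ G, ∃ d', (some V, d') ∈ ρ z)

theorem run_iff [Finite A] [Finite S] :
    ∃ δ : List (Trans A (Core A S × Core A S) (Option (Cl S))), ∀ (D : Type) (τ : DataTree A D)
      (bl : Pos → Core A S × Core A S) (ρ : Pos → Set (Option (Cl S) × D)),
      IsAcceptingRun none δ τ bl ρ ↔ (∀ x ∈ τ.pos, (ρ x).Finite) ∧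
        (∀ x ∈ τ.pos, IsLeaf τ x → ∃ d : D, ρ x = {(none, d)}) ∧
        ∀ x ∈ τ.pos, ∀ q d, (q, d) ∈ ρ x → ThreadOK edge e ok τ bl ρ x q d := by
  obtain ⟨δ, hδ⟩ := exists_auto edge e ok
  refine ⟨δ, fun D τ bl ρ => ?_⟩
  unfold IsAcceptingRun IsRun
  rw [and_assoc, and_assoc]
  refine and_congr_right fun _ => and_congr_right fun _ => ?_
  constructor
  · rintro ⟨h1, h2⟩ x hx q d hq
    rcases List.eq_nil_or_concat x with rfl | ⟨z, i, rfl⟩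
    · obtain ⟨t, ht1, ht2⟩ := h2 _ hq
      obtain ⟨j, hj, hja⟩ := (hδ D τ bl [] hx q d (fun l => l = [.accept])).1 ⟨_, ht1, ht2, rfl⟩
      rcases hj with ⟨rfl, _, h⟩ | ⟨_, _, _, _, h, _⟩
      · exact ⟨_, _, _, h, Or.inl ⟨rfl, rfl, rfl, rfl⟩⟩
      · exact absurd rfl h
    · simp only [List.concat_eq_append] at hx hq ⊢
      obtain ⟨tr, ht1, ht2, ht3⟩ := h1 z i hx _ hq
      obtain ⟨j, hj, hja⟩ := (hδ D τ bl _ hx q d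
        (fun l => ∀ a ∈ l, actOK τ (z ++ [i]) z ρ d a)).1 ⟨_, ht1, ht2, ht3⟩
      rcases hj with ⟨rfl, h, _⟩ | ⟨Vn, Vs, G, rfl, _, h⟩
      · simp at h
      · refine ⟨_, _, _, h, Or.inr ⟨z, i, rfl, ?_, ?_, ?_⟩⟩
        · exact hja (.keep (some Vn)) (by simp [acts])
        · exact hja (.store (some Vs)) (by simp [acts])
        · intro V hV
          exact hja (.guess (some V)) (by simp [acts, hV])
  · intro h
    constructor
    · rintro z i hx ⟨q, d⟩ hq
      obtain ⟨Vn, Vs, G, h1, ⟨h2, _⟩ | ⟨z', i', h2, h3, h4, h5⟩⟩ := h _ hx q d hq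
      · simp at h2
      · obtain ⟨rfl, h2⟩ := List.append_inj' h2 rfl
        refine (hδ D τ bl _ hx q d (fun l => ∀ a ∈ l, actOK τ (z ++ [i]) z ρ d a)).2
          ⟨some (Vn, Vs, G), Or.inr ⟨_, _, _, rfl, by simp, h1⟩, ?_⟩
        intro a ha
        simp only [acts, List.mem_cons, List.mem_map, Finset.mem_toList,
          Set.Finite.mem_toFinset] at ha
        rcases ha with rfl | rfl | ⟨V, hV, rfl⟩
        · exact h3
        · exact h4
        · exact h5 V hV
    · rintro ⟨q, d⟩ hq
      obtain ⟨Vn, Vs, G, h1, ⟨_, rfl, rfl, rfl⟩ | ⟨z', i', h2, _⟩⟩ := h _ τ.root_mem q d hq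
      · obtain ⟨tr, ht1, ht2, ht3⟩ := (hδ D τ bl [] τ.root_mem q d (fun l => l = [.accept])).2
          ⟨none, Or.inl ⟨rfl, rfl, h1⟩, rfl⟩
        obtain ⟨t, a⟩ := tr
        cases ht3
        exact ⟨t, ht1, ht2⟩
      · simp at h2

end Auto

section Graph2
variable {A D S : Type} {τ : DataTree A D} {E : Pos → Dir → S → S → Prop}

theorem headStep {x y : Pos} {i : ℕ} (hy : x ++ [i] <+: y) {p q : S}
    (h : Reach τ E x p y q) :
    ∃ p' p'', Reach τ E x p x p' ∧ E x .dn p' p'' ∧ Reach τ E (x ++ [i]) p'' y q := by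
  have key : ∀ v : Pos × S, Relation.ReflTransGen (stepR τ E) (x, p) v →
      x ++ [i] <+: v.1 → ∃ p' p'', Reach τ E x p x p' ∧ E x .dn p' p'' ∧
        Reach τ E (x ++ [i]) p'' v.1 v.2 := by
    intro v hv
    induction hv with
    | refl => exact fun h => absurd h (not_prefix_self_append _ _)
    | @tail u v hr hs ih =>
      intro hv
      by_cases hu : x ++ [i] <+: u.1
      · obtain ⟨p', p'', h1, h2, h3⟩ := ih hu
        exact ⟨p', p'', h1, h2, Relation.ReflTransGen.tail h3 hs⟩
      · obtain ⟨h5, h6, h7⟩ := step_enter hs hu hv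
        refine ⟨u.2, v.2, ?_, h7, ?_⟩
        · have : Reach τ E x p u.1 u.2 := hr
          rwa [h5] at this
        · rw [h6]
          exact .refl
  exact key _ h hy

theorem prefix_mem {x y : Pos} (h : x <+: y) : y ∈ τ.pos → x ∈ τ.pos := by
  obtain ⟨w, rfl⟩ := h
  induction w using List.reverseRecOn with
  | nil => simp
  | append_singleton w i ih =>
    intro h
    rw [← List.append_assoc] at h
    exact ih (τ.parent_closed _ _ h)

theorem prefix_cases {x y : Pos} (h : x <+: y) : y = x ∨ ∃ i : ℕ, x ++ [i] <+: y := by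
  obtain ⟨w, rfl⟩ := h
  cases w with
  | nil => simp
  | cons i w => exact Or.inr ⟨i, ⟨w, by simp⟩⟩

/-- The true claims about a datum. -/
def TT (τ : DataTree A D) (E : Pos → Dir → S → S → Prop) (e : S) (x : Pos) (d : D) : Cl S :=
  fun p r => ∃ y, Reach τ E x p y e ∧ sat r (τ.data y) d

theorem TT_trueW {e : S} {x : Pos} {d : D} {p q : S} {r : Bool} (h1 : TT τ E e x d p true)
    (h2 : TT τ E e x d q r) : trueW τ E e x p q r ∧ trueW τ E e x q p r := by
  obtain ⟨y, hy, h1⟩ := h1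
  obtain ⟨z, hz, h2⟩ := h2
  rw [sat_true] at h1
  subst h1
  exact ⟨⟨y, z, hy, hz, sat_symm h2⟩, ⟨z, y, hz, hy, h2⟩⟩

end Graph2

section Auto
variable {A D S : Type} {edge : Core A S → Dir → S → S → Prop} {e : S} {ok : Core A S → Prop}
  {τ : DataTree A D} {bl : Pos → Core A S × Core A S}

/-- The edges given by the labelling. -/
abbrev EE (edge : Core A S → Dir → S → S → Prop) (bl : Pos → Core A S × Core A S) :
    Pos → Dir → S → S → Prop := fun x => edge (bl x).1

theorem pth_none {w : List (A × (Core A S × Core A S))} {q : Option S}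
    (h : Pth (dnDelta edge e) Set.univ none w q) : False := by
  generalize hn : (none : Option S) = n at h
  cases h with
  | one h => subst hn; exact h
  | cons h _ _ => subst hn; exact h

theorem dnT_iff (hL : ∀ x ∈ τ.pos, ∀ p q, (bl x).1.L p q ↔ Reach τ (EE edge bl) x p x q)
    {x : Pos} (hx : x ∈ τ.pos) (d : D) (p : S) (r : Bool) :
    dnT edge e τ bl x d p r ↔
      ∃ y, x <+: y ∧ Reach τ (EE edge bl) x p y e ∧ sat r (τ.data y) d := by
  constructor
  · rintro ⟨l, y, hl, hy, hp, hs⟩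
    have key : ∀ (l : List Pos) (x : Pos) (p : S), IsDownPath τ x l → l.getLast? = some y →
        Pth (dnDelta edge e) Set.univ (some p) (l.map fun z => (τ.label z, bl z)) none →
        x <+: y ∧ Reach τ (EE edge bl) x p y e := by
      intro l
      induction l with
      | nil => exact fun x p hl => absurd rfl hl.1
      | cons a l ih =>
        intro x p hl hy hp
        cases l with
        | nil =>
          obtain ⟨rfl, hx⟩ := isDownPath_one.1 hl
          simp at hy
          subst hy
          refine ⟨List.prefix_rfl, ?_⟩
          cases hp with
          | one h => exact (hL _ hx _ _).1 h
          | cons _ _ h => cases h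
        | cons b l =>
          obtain ⟨rfl, hx, ⟨i, rfl⟩, h2⟩ := isDownPath_cons.1 hl
          cases hp with
          | @cons _ _ m _ _ h3 _ h4 =>
            cases m with
            | none => exact (pth_none h4).elim
            | some m =>
              have := ih _ m h2 (by simpa using hy) h4
              obtain ⟨p0, h5, h6⟩ := h3
              refine ⟨(List.prefix_append _ _).trans this.1, ?_⟩
              exact (((hL _ hx _ _).1 h5).trans
                (reach_dn (E := EE edge bl) (h2.2.2.1 _ (by simp)) h6).toReach).trans this.2
    obtain ⟨h1, h2⟩ := key l x p hl hy hp
    exact ⟨y, h1, h2, hs⟩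
  · rintro ⟨y, ⟨w, rfl⟩, hr, hs⟩
    have key : ∀ (w x : Pos) (p : S), x ∈ τ.pos → Reach τ (EE edge bl) x p (x ++ w) e →
        ∃ l, IsDownPath τ x (x :: l) ∧ (x :: l).getLast? = some (x ++ w) ∧
          Pth (dnDelta edge e) Set.univ (some p) ((x :: l).map fun z => (τ.label z, bl z)) none := by
      intro w
      induction w with
      | nil =>
        intro x p hx h
        simp only [List.append_nil] at h
        exact ⟨[], isDownPath_one.2 ⟨rfl, hx⟩, by simp, .one ((hL _ hx _ _).2 h)⟩
      | cons i w ih =>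
        intro x p hx h
        have hpre : x ++ [i] <+: x ++ i :: w := ⟨w, by simp⟩
        obtain ⟨p', p'', h1, h2, h3⟩ := headStep hpre h
        have hm := prefix_mem hpre (h.mem hx)
        rw [show x ++ i :: w = (x ++ [i]) ++ w by simp] at h3 ⊢
        obtain ⟨l, h4, h5, h6⟩ := ih _ _ hm h3
        exact ⟨_, isDownPath_cons.2 ⟨rfl, hx, ⟨i, rfl⟩, h4⟩, by simpa using h5,
          .cons (m := some p'') ⟨p', (hL _ hx _ _).2 h1, h2⟩ trivial h6⟩
    obtain ⟨l, h1, h2, h3⟩ := key w x p hx hr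
    exact ⟨_, _, h1, h2, h3, hs⟩

theorem TT_root (hL : ∀ x ∈ τ.pos, ∀ p q, (bl x).1.L p q ↔ Reach τ (EE edge bl) x p x q)
    (d : D) (p : S) (r : Bool) :
    TT τ (EE edge bl) e [] d p r ↔ dnT edge e τ bl [] d p r := by
  rw [dnT_iff hL τ.root_mem]
  simp [TT]

theorem coreU_iff (hL : ∀ x ∈ τ.pos, ∀ p q, (bl x).1.L p q ↔ Reach τ (EE edge bl) x p x q)
    {z : Pos} {i : ℕ} (hx : z ++ [i] ∈ τ.pos) {p p1 : S} :
    coreU edge (bl (z ++ [i])).1 p p1 ↔ ∃ p', Reach τ (EE edge bl) (z ++ [i]) p (z ++ [i]) p' ∧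
      EE edge bl (z ++ [i]) .up p' p1 := by
  simp only [coreU, hL _ hx]

theorem coreU_reach (hL : ∀ x ∈ τ.pos, ∀ p q, (bl x).1.L p q ↔ Reach τ (EE edge bl) x p x q)
    {z : Pos} {i : ℕ} (hx : z ++ [i] ∈ τ.pos) {p p1 : S}
    (h : coreU edge (bl (z ++ [i])).1 p p1) {y : Pos} {q : S}
    (h1 : Reach τ (EE edge bl) z p1 y q) : Reach τ (EE edge bl) (z ++ [i]) p y q := by
  obtain ⟨p', h2, h3⟩ := (coreU_iff hL hx).1 h
  exact upStep' hx h2 h3 h1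

theorem reach_coreU (hL : ∀ x ∈ τ.pos, ∀ p q, (bl x).1.L p q ↔ Reach τ (EE edge bl) x p x q)
    {z : Pos} {i : ℕ} (hx : z ++ [i] ∈ τ.pos) {p : S} {y : Pos} {q : S}
    (hy : ¬ z ++ [i] <+: y) (h1 : Reach τ (EE edge bl) (z ++ [i]) p y q) :
    ∃ p1, coreU edge (bl (z ++ [i])).1 p p1 ∧ Reach τ (EE edge bl) z p1 y q := by
  obtain ⟨p', p1, h2, h3, h4⟩ := upStep hy h1
  exact ⟨p1, (coreU_iff hL hx).2 ⟨p', h2, h3⟩, h4⟩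

theorem TT_child (hL : ∀ x ∈ τ.pos, ∀ p q, (bl x).1.L p q ↔ Reach τ (EE edge bl) x p x q)
    {z : Pos} {i : ℕ} (hx : z ++ [i] ∈ τ.pos) (d : D) (p : S) (r : Bool) :
    TT τ (EE edge bl) e (z ++ [i]) d p r ↔ dnT edge e τ bl (z ++ [i]) d p r ∨
      ∃ p1, coreU edge (bl (z ++ [i])).1 p p1 ∧ TT τ (EE edge bl) e z d p1 r := by
  rw [dnT_iff hL hx]
  constructor
  · rintro ⟨y, h1, h2⟩
    by_cases hy : z ++ [i] <+: y
    · exact Or.inl ⟨y, hy, h1, h2⟩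
    · obtain ⟨p1, h3, h4⟩ := reach_coreU hL hx hy h1
      exact Or.inr ⟨p1, h3, y, h4, h2⟩
  · rintro (⟨y, _, h1, h2⟩ | ⟨p1, h3, y, h4, h2⟩)
    · exact ⟨y, h1, h2⟩
    · exact ⟨y, coreU_reach hL hx h3 h4, h2⟩

/-- Claims made from the parent. -/
def PC (τ : DataTree A D) (E : Pos → Dir → S → S → Prop) (e : S) (x : Pos) (d : D) (V : Cl S) :
    Prop :=
  (x = [] ∧ V = noCl) ∨ ∃ (z : Pos) (i : ℕ), x = z ++ [i] ∧ V = TT τ E e z d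

theorem TT_PC (hL : ∀ x ∈ τ.pos, ∀ p q, (bl x).1.L p q ↔ Reach τ (EE edge bl) x p x q)
    {x : Pos} (hx : x ∈ τ.pos) {d : D} {V : Cl S} (hV : PC τ (EE edge bl) e x d V)
    (p : S) (r : Bool) :
    TT τ (EE edge bl) e x d p r ↔ dnT edge e τ bl x d p r ∨
      ∃ p1, coreU edge (bl x).1 p p1 ∧ V p1 r := by
  rcases hV with ⟨rfl, rfl⟩ | ⟨z, i, rfl, rfl⟩
  · simp [TT_root hL, noCl]
  · exact TT_child hL hx d p r

theorem coreV_sound (hL : ∀ x ∈ τ.pos, ∀ p q, (bl x).1.L p q ↔ Reach τ (EE edge bl) x p x q)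
    {x : Pos} (hx : x ∈ τ.pos) {V : Cl S} (hV : PC τ (EE edge bl) e x (τ.data x) V)
    {p : S} {r : Bool} (h : coreV edge e (bl x).1 V p r) :
    TT τ (EE edge bl) e x (τ.data x) p r := by
  rcases h with ⟨rfl, h⟩ | h
  · exact ⟨x, (hL _ hx _ _).1 h, sat_true.2 rfl⟩
  · exact (TT_PC hL hx hV p r).2 (Or.inr h)

theorem coreV_complete (hL : ∀ x ∈ τ.pos, ∀ p q, (bl x).1.L p q ↔ Reach τ (EE edge bl) x p x q)
    {x : Pos} (hx : x ∈ τ.pos) {V : Cl S} (hV : PC τ (EE edge bl) e x (τ.data x) V)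
    {p : S} {r : Bool} {y : Pos} (hy : y = x ∨ ¬ x <+: y) (h : Reach τ (EE edge bl) x p y e)
    (hs : sat r (τ.data y) (τ.data x)) : coreV edge e (bl x).1 V p r := by
  rcases hy with rfl | hy
  · exact Or.inl ⟨hs.2 rfl, (hL _ hx _ _).2 h⟩
  · rcases hV with ⟨rfl, rfl⟩ | ⟨z, i, rfl, rfl⟩
    · simp at hy
    · obtain ⟨p1, h3, h4⟩ := reach_coreU hL hx hy h
      exact Or.inr ⟨p1, h3, y, h4, hs⟩

/-- The labelling is correct. -/
structure Good (edge : Core A S → Dir → S → S → Prop) (e : S) (τ : DataTree A D)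
    (core : Pos → Core A S) : Prop where
  lab : ∀ x ∈ τ.pos, (core x).lab = τ.label x
  BL : ∀ x ∈ τ.pos, ∀ p q, (core x).BL p q ↔ ReachIn τ (fun x => edge (core x)) x x p x q
  L : ∀ x ∈ τ.pos, ∀ p q, (core x).L p q ↔ Reach τ (fun x => edge (core x)) x p x q
  W : ∀ x ∈ τ.pos, ∀ p q r, (core x).W p q r ↔ trueW τ (fun x => edge (core x)) e x p q r

theorem rtg_congr {α : Type} {R R' : α → α → Prop} (h : ∀ x y, R x y ↔ R' x y) (x y : α) :
    Relation.ReflTransGen R x y ↔ Relation.ReflTransGen R' x y :=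
  ⟨rtg_mono fun a b => (h a b).1, rtg_mono fun a b => (h a b).2⟩

theorem auto_sound {ρ : Pos → Set (Option (Cl S) × D)}
    (hleaf : ∀ x ∈ τ.pos, IsLeaf τ x → ∃ d : D, ρ x = {(none, d)})
    (hth : ∀ x ∈ τ.pos, ∀ q d, (q, d) ∈ ρ x → ThreadOK edge e ok τ bl ρ x q d) :
    Good edge e τ (fun x => (bl x).1) ∧ ok (bl []).1 := by
  have hch : ∀ (x : Pos) (i : ℕ), x ++ [i] ∈ τ.pos → chT τ bl x (bl (x ++ [i])) :=
    fun x i h => ⟨i, h, rfl⟩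
  have hpar : ∀ (x : Pos) (i : ℕ), x ++ [i] ∈ τ.pos → ∀ q d, (q, d) ∈ ρ (x ++ [i]) →
      ∃ Vn Vs G, RelC edge e ok q (τ.label (x ++ [i])) (bl (x ++ [i])) False
        (IsLeaf τ (x ++ [i])) (dnT edge e τ bl (x ++ [i]) d)
        (chT τ bl (x ++ [i])) Vn Vs G ∧ (some Vn, d) ∈ ρ x ∧
        (some Vs, τ.data (x ++ [i])) ∈ ρ x ∧ ∀ V ∈ G, ∃ d', (some V, d') ∈ ρ x := by
    intro x i hx q d hq
    obtain ⟨Vn, Vs, G, h1, ⟨h2, _⟩ | ⟨z, j, h2, h3⟩⟩ := hth _ hx q d hq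
    · simp at h2
    · obtain ⟨rfl, h4⟩ := List.append_inj' h2 rfl
      refine ⟨Vn, Vs, G, ?_, h3⟩
      simpa using h1
  have hex : ∀ x ∈ τ.pos, ∃ q d, (q, d) ∈ ρ x := by
    refine bottomUp τ fun x hx ih => ?_
    by_cases hl : IsLeaf τ x
    · obtain ⟨d, hd⟩ := hleaf x hx hl
      exact ⟨none, d, by simp [hd]⟩
    · simp only [IsLeaf, not_forall, not_not] at hl
      obtain ⟨i, hi⟩ := hl
      obtain ⟨q, d, hq⟩ := ih i hi
      obtain ⟨Vn, _, _, _, h, _⟩ := hpar x i hi q d hq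
      exact ⟨_, _, h⟩
  have hrel : ∀ x ∈ τ.pos, ∃ q d Vn Vs G, RelC edge e ok q (τ.label x) (bl x) (x = [])
      (IsLeaf τ x) (dnT edge e τ bl x d) (chT τ bl x) Vn Vs G ∧
      ((x = [] ∧ Vn = noCl ∧ Vs = noCl ∧ G = ∅) ∨
      ∃ (z : Pos) (i : ℕ), x = z ++ [i] ∧ (some Vn, d) ∈ ρ z ∧ (some Vs, τ.data x) ∈ ρ z ∧
        ∀ V ∈ G, ∃ d', (some V, d') ∈ ρ z) := by
    intro x hx
    obtain ⟨q, d, hq⟩ := hex x hx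
    obtain ⟨Vn, Vs, G, h⟩ := hth x hx q d hq
    exact ⟨q, d, Vn, Vs, G, h⟩
  have hBL : ∀ x ∈ τ.pos, ∀ p q, (bl x).1.BL p q ↔ ReachIn τ (EE edge bl) x x p x q := by
    refine bottomUp τ fun x hx ih => ?_
    intro p q
    obtain ⟨_, _, _, _, _, h, _⟩ := hrel x hx
    rw [belowLoop hx, h.bl]
    refine rtg_congr (fun p q => ?_) p q
    refine or_congr_right ?_
    constructor
    · rintro ⟨c, ⟨i, hi, rfl⟩, p0, q0, h1, h2, h3⟩
      exact ⟨i, hi, p0, q0, h1, (ih i hi _ _).1 h2, h3⟩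
    · rintro ⟨i, hi, p0, q0, h1, h2, h3⟩
      exact ⟨_, hch x i hi, p0, q0, h1, (ih i hi _ _).2 h2, h3⟩
  have hL : ∀ x ∈ τ.pos, ∀ p q, (bl x).1.L p q ↔ Reach τ (EE edge bl) x p x q := by
    refine topDown τ ?_ ?_
    · intro p q
      obtain ⟨_, _, _, _, _, h, _⟩ := hrel [] τ.root_mem
      rw [h.rootL rfl, hBL _ τ.root_mem, reach_root]
    · intro x i hi ih p q
      have hx := τ.parent_closed _ _ hi
      obtain ⟨_, _, _, _, _, h, _⟩ := hrel x hx
      rw [fullLoop hi, h.l _ (hch x i hi)]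
      refine rtg_congr (fun p q => ?_) p q
      simp only [loopC, hBL _ hi, ih]
  have hT : ∀ x ∈ τ.pos, ∀ V d, (some V, d) ∈ ρ x → V = TT τ (EE edge bl) e x d := by
    refine topDown τ ?_ ?_
    · intro V d hq
      obtain ⟨Vn, Vs, G, h1, ⟨_, rfl, _⟩ | ⟨z, j, h2, h3⟩⟩ := hth _ τ.root_mem _ d hq
      · funext p r
        rw [TT_root hL]
        have := h1.claim V rfl p r
        simpa [noCl] using this
      · simp at h2
    · intro x i hi ih V d hq
      obtain ⟨Vn, Vs, G, h1, h2, _⟩ := hpar x i hi _ d hq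
      funext p r
      rw [TT_child hL hi, ← ih _ _ h2]
      exact propext (h1.claim V rfl p r)
  have hdata : ∀ x ∈ τ.pos, ∀ (i : ℕ) (y : Pos), x ++ [i] <+: y → y ∈ τ.pos →
      ∃ V, (some V, τ.data y) ∈ ρ x := by
    refine bottomUp τ fun x hx ih => ?_
    intro i y hy hym
    have hi := prefix_mem hy hym
    rcases prefix_cases hy with rfl | ⟨j, hj⟩
    · obtain ⟨q, d, hq⟩ := hex _ hi
      obtain ⟨_, Vs, _, _, _, h, _⟩ := hpar x i hi q d hq
      exact ⟨_, h⟩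
    · obtain ⟨V, hV⟩ := ih i hi j y hj hym
      obtain ⟨Vn, _, _, _, h, _⟩ := hpar x i hi _ _ hV
      exact ⟨_, h⟩
  have hPC : ∀ x ∈ τ.pos, ∃ q d Vn Vs G, RelC edge e ok q (τ.label x) (bl x) (x = [])
      (IsLeaf τ x) (dnT edge e τ bl x d) (chT τ bl x) Vn Vs G ∧
      PC τ (EE edge bl) e x (τ.data x) Vs ∧
      ∀ V ∈ G, ∃ z i d', x = z ++ [i] ∧ (some V, d') ∈ ρ z := by
    intro x hx
    obtain ⟨q, d, Vn, Vs, G, h, ⟨rfl, rfl, rfl, rfl⟩ | ⟨z, i, rfl, h1, h2, h3⟩⟩ := hrel x hx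
    · exact ⟨q, d, _, _, _, h, Or.inl ⟨rfl, rfl⟩, by simp⟩
    · refine ⟨q, d, _, _, _, h,
        Or.inr ⟨z, i, rfl, hT _ (τ.parent_closed _ _ hx) _ _ h2⟩, fun V hV => ?_⟩
      obtain ⟨d', hd⟩ := h3 V hV
      exact ⟨z, i, d', rfl, hd⟩
  have hW1 : ∀ x ∈ τ.pos, ∀ p q r, (bl x).1.W p q r → trueW τ (EE edge bl) e x p q r := by
    intro x hx p q r hW
    by_cases hl : IsLeaf τ x
    · obtain ⟨_, _, Vn, Vs, G, h, hVs, hG⟩ := hPC x hx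
      rcases h.leafOb hl p q r hW with ⟨h1, h2⟩ | ⟨h1, h2⟩ | ⟨V, hV, p1, q1, h1, h2, h3, h4⟩
      · exact (TT_trueW (coreV_sound hL hx hVs h1) (coreV_sound hL hx hVs h2)).1
      · exact (TT_trueW (coreV_sound hL hx hVs h1) (coreV_sound hL hx hVs h2)).2
      · obtain ⟨z, i, d', rfl, hd⟩ := hG V hV
        have hz := τ.parent_closed _ _ hx
        rw [hT z hz _ _ hd] at h3 h4
        obtain ⟨y1, y2, hy1, hy2, hs⟩ := (TT_trueW h3 h4).1
        exact ⟨y1, y2, coreU_reach hL hx h1 hy1, coreU_reach hL hx h2 hy2, hs⟩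
    · simp only [IsLeaf, not_forall, not_not] at hl
      obtain ⟨i, hi⟩ := hl
      obtain ⟨q', d, hq⟩ := hex _ hi
      obtain ⟨_, _, G, h1, _, _, hG⟩ := hpar x i hi q' d hq
      obtain ⟨_, _, _, _, _, h, _⟩ := hrel x hx
      rw [← h.par _ (hch x i hi)] at hW
      obtain ⟨V, hV, h2, h3⟩ := h1.parOb (by simp) p q r hW
      obtain ⟨d', hd⟩ := hG V hV
      rw [hT x hx _ _ hd] at h2 h3
      exact (TT_trueW h2 h3).1
  have hW2 : ∀ x ∈ τ.pos, ∀ p q r, trueW τ (EE edge bl) e x p q r → (bl x).1.W p q r := by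
    have hcase : ∀ x ∈ τ.pos, ∀ p q r y1 y2, Reach τ (EE edge bl) x p y1 e →
        Reach τ (EE edge bl) x q y2 e → sat r (τ.data y1) (τ.data y2) → x <+: y1 →
        (bl x).1.W p q r ∧ (bl x).1.W q p r := by
      have hstrict : ∀ x ∈ τ.pos, ∀ p q r y1 y2, Reach τ (EE edge bl) x p y1 e →
          Reach τ (EE edge bl) x q y2 e → sat r (τ.data y1) (τ.data y2) →
          (∃ i : ℕ, x ++ [i] <+: y1) → (bl x).1.W p q r ∧ (bl x).1.W q p r := by
        rintro x hx p q r y1 y2 h1 h2 hs ⟨i, hi⟩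
        obtain ⟨V, hV⟩ := hdata x hx i y1 hi (h1.mem hx)
        obtain ⟨_, _, _, h, _⟩ := hth x hx _ _ hV
        have hVT := hT x hx _ _ hV
        refine h.chk V rfl p q r ?_ ?_
        · rw [hVT]
          exact ⟨y1, h1, sat_true.2 rfl⟩
        · rw [hVT]
          exact ⟨y2, h2, sat_symm hs⟩
      intro x hx p q r y1 y2 h1 h2 hs hpre
      rcases prefix_cases hpre with rfl | hi
      · by_cases hy2 : y1 <+: y2 ∧ y2 ≠ y1
        · rcases prefix_cases hy2.1 with h | hi
          · exact absurd h hy2.2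
          · exact (hstrict y1 hx q p r y2 y1 h2 h1 (sat_symm hs) hi).symm
        · have hy2' : y2 = y1 ∨ ¬ y1 <+: y2 := by tauto
          obtain ⟨_, _, Vn, Vs, G, h, hVs, hG⟩ := hPC y1 hx
          exact h.own p q r (coreV_complete hL hx hVs (Or.inl rfl) h1 (sat_true.2 rfl))
            (coreV_complete hL hx hVs hy2' h2 (sat_symm hs))
      · exact hstrict x hx p q r y1 y2 h1 h2 hs hi
    refine topDown τ ?_ ?_
    · rintro p q r ⟨y1, y2, h1, h2, hs⟩
      exact (hcase [] τ.root_mem p q r y1 y2 h1 h2 hs (by simp)).1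
    · rintro x i hi ih p q r ⟨y1, y2, h1, h2, hs⟩
      by_cases hy1 : x ++ [i] <+: y1
      · exact (hcase _ hi p q r y1 y2 h1 h2 hs hy1).1
      · by_cases hy2 : x ++ [i] <+: y2
        · exact (hcase _ hi q p r y2 y1 h2 h1 (sat_symm hs) hy2).2
        · obtain ⟨p1, h3, h4⟩ := reach_coreU hL hi hy1 h1
          obtain ⟨q1, h5, h6⟩ := reach_coreU hL hi hy2 h2
          obtain ⟨_, _, _, _, _, h, _⟩ := hrel x (τ.parent_closed _ _ hi)
          exact h.w _ (hch x i hi) p q p1 q1 r h3 h5 (ih _ _ _ ⟨y1, y2, h4, h6, hs⟩)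
  refine ⟨⟨?_, hBL, hL, fun x hx p q r => ⟨hW1 x hx p q r, hW2 x hx p q r⟩⟩, ?_⟩
  · intro x hx
    obtain ⟨_, _, _, _, _, h, _⟩ := hrel x hx
    exact h.lab
  · obtain ⟨_, _, _, _, _, h, _⟩ := hrel [] τ.root_mem
    exact h.rootOk rfl

end Auto

section Auto
variable {A D S : Type} {edge : Core A S → Dir → S → S → Prop} {e : S} {ok : Core A S → Prop}
  {τ : DataTree A D}

/-- The labelling of the canonical run. -/
def blC (core : Pos → Core A S) (x : Pos) : Core A S × Core A S := (core x, core x.dropLast)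

/-- The canonical run. -/
def rhoC (edge : Core A S → Dir → S → S → Prop) (e : S) (τ : DataTree A D)
    (core : Pos → Core A S) (x : Pos) : Set (Option (Cl S) × D) :=
  {qd | (IsLeaf τ x ∧ qd = (none, τ.data x)) ∨ (¬ IsLeaf τ x ∧ ∃ y ∈ τ.pos,
    qd = (some (TT τ (EE edge (blC core)) e x (τ.data y)), τ.data y))}

theorem auto_rel {core : Pos → Core A S} (hG : Good edge e τ core) (hok : ok (core []))
    {x : Pos} (hx : x ∈ τ.pos) {q : Option (Cl S)} {d : D}
    (hq : ∀ V, q = some V → V = TT τ (EE edge (blC core)) e x d)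
    {Vn Vs : Cl S} {G : Set (Cl S)} (hVn : PC τ (EE edge (blC core)) e x d Vn)
    (hVs : PC τ (EE edge (blC core)) e x (τ.data x) Vs)
    (hGG : ∀ (z : Pos) (i : ℕ), x = z ++ [i] → ∀ y ∈ τ.pos,
      TT τ (EE edge (blC core)) e z (τ.data y) ∈ G) :
    RelC edge e ok q (τ.label x) (blC core x) (x = []) (IsLeaf τ x)
      (dnT edge e τ (blC core) x d) (chT τ (blC core) x) Vn Vs G := by
  have hL : ∀ x ∈ τ.pos, ∀ p q, (blC core x).1.L p q ↔ Reach τ (EE edge (blC core)) x p x q := hG.L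
  have hBL : ∀ x ∈ τ.pos, ∀ p q, (blC core x).1.BL p q ↔
    ReachIn τ (EE edge (blC core)) x x p x q := hG.BL
  have hW : ∀ x ∈ τ.pos, ∀ p q r, (blC core x).1.W p q r ↔
    trueW τ (EE edge (blC core)) e x p q r := hG.W
  constructor
  · exact hG.lab x hx
  · rintro c ⟨i, hi, rfl⟩
    simp [blC]
  · intro p q
    rw [hBL x hx, belowLoop hx]
    refine rtg_congr (fun p q => ?_) p q
    refine or_congr_right ?_
    constructor
    · rintro ⟨i, hi, p0, q0, h1, h2, h3⟩
      exact ⟨_, ⟨i, hi, rfl⟩, p0, q0, h1, (hBL _ hi _ _).2 h2, h3⟩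
    · rintro ⟨c, ⟨i, hi, rfl⟩, p0, q0, h1, h2, h3⟩
      exact ⟨i, hi, p0, q0, h1, (hBL _ hi _ _).1 h2, h3⟩
  · rintro c ⟨i, hi, rfl⟩ p q
    rw [hL _ hi, fullLoop hi]
    refine rtg_congr (fun p q => ?_) p q
    simp only [loopC, hBL _ hi, hL _ hx]
  · rintro c ⟨i, hi, rfl⟩ p q p1 q1 r h1 h2 h3
    rw [hW _ hi]
    obtain ⟨y1, y2, h4, h5, hs⟩ := (hW _ hx _ _ _).1 h3
    exact ⟨y1, y2, coreU_reach hL hi h1 h4, coreU_reach hL hi h2 h5, hs⟩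
  · rintro rfl p q
    rw [hL _ hx, hBL _ hx, reach_root]
  · rintro rfl
    exact hok
  · intro V hV p q r h1 h2
    rw [hq V hV] at h1 h2
    rw [hW _ hx, hW _ hx]
    exact TT_trueW h1 h2
  · intro V hV p r
    rw [hq V hV]
    exact TT_PC hL hx hVn p r
  · intro p q r h1 h2
    rw [hW _ hx, hW _ hx]
    exact TT_trueW (coreV_sound hL hx hVs h1) (coreV_sound hL hx hVs h2)
  · intro hl p q r hw
    obtain ⟨y1, y2, h1, h2, hs⟩ := (hW _ hx _ _ _).1 hw
    have hin : ∀ y ∈ τ.pos, y = x ∨ ¬ x <+: y := by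
      intro y hy
      by_contra hn
      have hn : y ≠ x ∧ x <+: y := by tauto
      rcases prefix_cases hn.2 with h | ⟨i, h⟩
      · exact hn.1 h
      · exact hl i (prefix_mem h hy)
    have m1 := hin y1 (h1.mem hx)
    have m2 := hin y2 (h2.mem hx)
    rcases m1 with rfl | m1
    · exact Or.inl ⟨coreV_complete hL hx hVs (Or.inl rfl) h1 (sat_true.2 rfl),
        coreV_complete hL hx hVs m2 h2 (sat_symm hs)⟩
    · rcases m2 with rfl | m2
      · exact Or.inr (Or.inl ⟨coreV_complete hL hx hVs (Or.inl rfl) h2 (sat_true.2 rfl),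
          coreV_complete hL hx hVs (Or.inr m1) h1 hs⟩)
      · right; right
        rcases List.eq_nil_or_concat x with rfl | ⟨z, i, rfl⟩
        · simp at m1
        · simp only [List.concat_eq_append] at *
          obtain ⟨p1, h3, h4⟩ := reach_coreU hL hx m1 h1
          obtain ⟨q1, h5, h6⟩ := reach_coreU hL hx m2 h2
          exact ⟨_, hGG z i rfl y1 (h1.mem hx), p1, q1, h3, h5, ⟨y1, h4, sat_true.2 rfl⟩,
            ⟨y2, h6, sat_symm hs⟩⟩
  · intro hr p q r hw
    rcases List.eq_nil_or_concat x with rfl | ⟨z, i, rfl⟩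
    · exact absurd rfl hr
    · simp only [List.concat_eq_append] at *
      have hz := τ.parent_closed _ _ hx
      have : (blC core (z ++ [i])).2 = core z := by simp [blC]
      rw [this] at hw
      obtain ⟨y1, y2, h1, h2, hs⟩ := (hG.W _ hz _ _ _).1 hw
      exact ⟨_, hGG z i rfl y1 (h1.mem hz), ⟨y1, h1, sat_true.2 rfl⟩, ⟨y2, h2, sat_symm hs⟩⟩

theorem auto_iff (edge : Core A S → Dir → S → S → Prop) (e : S) (ok : Core A S → Prop)
    [Finite A] [Finite S] :
    ∃ δ : List (Trans A (Core A S × Core A S) (Option (Cl S))), ∀ (D : Type) (τ : DataTree A D),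
      (∃ (bl : Pos → Core A S × Core A S) (ρ : Pos → Set (Option (Cl S) × D)),
        IsAcceptingRun none δ τ bl ρ) ↔ ∃ core, Good edge e τ core ∧ ok (core []) := by
  obtain ⟨δ, hδ⟩ := run_iff edge e ok
  refine ⟨δ, fun D τ => ?_⟩
  simp only [hδ]
  constructor
  · rintro ⟨bl, ρ, _, h1, h2⟩
    exact ⟨_, auto_sound h1 h2⟩
  · rintro ⟨core, hG, hok⟩
    refine ⟨blC core, rhoC edge e τ core, ?_, ?_, ?_⟩
    · intro x hx
      refine Set.Finite.subset (Set.Finite.union (Set.finite_singleton (none, τ.data x))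
        ((τ.pos.finite_toSet).image
          (fun y => (some (TT τ (EE edge (blC core)) e x (τ.data y)), τ.data y)))) ?_
      rintro qd (⟨_, h⟩ | ⟨_, y, hy, h⟩)
      · exact Or.inl h
      · exact Or.inr ⟨y, hy, h.symm⟩
    · intro x hx hl
      refine ⟨τ.data x, ?_⟩
      ext qd
      simp [rhoC, hl]
    · intro x hx q d hq
      have hd : ∃ y ∈ τ.pos, d = τ.data y := by
        rcases hq with ⟨_, h⟩ | ⟨_, y, hy, h⟩
        · cases h; exact ⟨x, hx, rfl⟩
        · cases h; exact ⟨y, hy, rfl⟩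
      have hV : ∀ V, q = some V → V = TT τ (EE edge (blC core)) e x d := by
        rintro V rfl
        rcases hq with ⟨_, h⟩ | ⟨_, y, hy, h⟩
        · cases h
        · cases h; rfl
      rcases List.eq_nil_or_concat x with rfl | ⟨z, i, rfl⟩
      · exact ⟨noCl, noCl, ∅, auto_rel hG hok hx hV (Or.inl ⟨rfl, rfl⟩) (Or.inl ⟨rfl, rfl⟩)
          (by simp), Or.inl ⟨rfl, rfl, rfl, rfl⟩⟩
      · simp only [List.concat_eq_append] at *
        have hl : ¬ IsLeaf τ z := fun h => h i hx
        refine ⟨TT τ (EE edge (blC core)) e z d,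
          TT τ (EE edge (blC core)) e z (τ.data (z ++ [i])),
          {V | ∃ y ∈ τ.pos, V = TT τ (EE edge (blC core)) e z (τ.data y)},
          auto_rel hG hok hx hV (Or.inr ⟨z, i, rfl, rfl⟩) (Or.inr ⟨z, i, rfl, rfl⟩) ?_,
          Or.inr ⟨z, i, rfl, ?_, ?_, ?_⟩⟩
        · rintro z' i' h y hy
          obtain ⟨rfl, _⟩ := List.append_inj' h rfl
          exact ⟨y, hy, rfl⟩
        · obtain ⟨y, hy, rfl⟩ := hd
          exact Or.inr ⟨hl, y, hy, rfl⟩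
        · exact Or.inr ⟨hl, _, hx, rfl⟩
        · rintro V ⟨y, hy, rfl⟩
          exact ⟨τ.data y, Or.inr ⟨hl, y, hy, rfl⟩⟩

end Auto

section Final
variable {A D : Type}

theorem star_down_root (τ : DataTree A D) : ∀ x ∈ τ.pos,
    pathSem τ (.star .down) [] x := by
  refine topDown τ ?_ ?_
  · simp only [pathSem]
    exact ⟨τ.root_mem, .refl⟩
  · intro x i hi ih
    simp only [pathSem] at ih ⊢
    exact ⟨τ.root_mem, ih.2.tail ⟨hi, i, rfl⟩⟩

/-- The node expression stating at the root that the given one holds somewhere. -/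
def somewhere (η : NodeE A) : NodeE A := .somePath (.testR (.star .down) η)

theorem somewhere_iff (τ : DataTree A D) (η : NodeE A) :
    nodeSem τ (somewhere η) [] ↔ ∃ x ∈ τ.pos, nodeSem τ η x := by
  simp only [somewhere, nodeSem]
  constructor
  · rintro ⟨y, h⟩
    simp only [pathSem] at h
    refine ⟨y, ?_, h.2⟩
    rcases Relation.ReflTransGen.cases_tail h.1.2 with rfl | ⟨c, _, h, _⟩
    · exact τ.root_mem
    · exact h
  · rintro ⟨x, hx, h⟩
    refine ⟨x, ?_⟩
    have := star_down_root τ x hx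
    simp only [pathSem] at this ⊢
    exact ⟨this, h⟩

theorem good_iff (τ : DataTree A D) (η : NodeE A) {s : Set (PathE A)} (hs : StpClosed s)
    (he : .eps ∈ s) (hη : allN η ⊆ s) :
    (∃ core, Good (fun c : Core A s => opS s (fun φ => allN φ ⊆ s ∧ evalN s c.lab c.W φ))
      ⟨.eps, he⟩ τ core ∧ evalN s (core []).lab (core []).W η) ↔ nodeSem τ η [] := by
  constructor
  · rintro ⟨core, hG, hok⟩
    have := evalN_iff (τ := τ) (H := fun x φ => allN φ ⊆ s ∧ evalN s (core x).lab (core x).W φ)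
      (W := fun x => (core x).W) (he := he) hs hG.W (by
        intro x hx φ hφ h
        simp only [hφ, true_and]
        rw [hG.lab x hx]
        exact h) η hη [] τ.root_mem
    rw [← this, ← hG.lab _ τ.root_mem]
    exact hok
  · intro h
    let H : Pos → NodeE A → Prop := fun x φ => allN φ ⊆ s ∧ nodeSem τ φ x
    let E : Pos → Dir → s → s → Prop := fun x => opS s (H x)
    let core : Pos → Core A s := fun x => ⟨τ.label x, fun p q => ReachIn τ E x x p x q,
      fun p q => Reach τ E x p x q, trueW τ E ⟨.eps, he⟩ x⟩
    have key := evalN_iff (τ := τ) (H := H)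
      (W := fun x => (core x).W) (he := he) hs (fun x _ p q r => Iff.rfl) (by
        intro x hx φ hφ h
        simp [H, hφ])
    have hE : ∀ x ∈ τ.pos, opS s (fun φ => allN φ ⊆ s ∧
        evalN s (core x).lab (core x).W φ) = E x := by
      intro x hx
      have : (fun φ => allN φ ⊆ s ∧ evalN s (core x).lab (core x).W φ) = H x := by
        funext φ
        exact propext (and_congr_right fun hφ => key φ hφ x hx)
      rw [this]
    obtain ⟨h1, h2⟩ := reach_congr (τ := τ) hE
    refine ⟨core, ⟨fun _ _ => rfl, ?_, ?_, ?_⟩, ?_⟩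
    · intro x hx p q
      rw [h2]
    · intro x hx p q
      rw [h1]
    · intro x hx p q r
      unfold trueW
      rw [h1]
      rfl
    · exact (key η hη [] τ.root_mem).2 h

theorem exists_budta [Finite A] (η : NodeE A) :
    ∃ M : BUDTA A, ∀ (D : Type) (τ : DataTree A D),
      Accepts M τ ↔ ∃ x ∈ τ.pos, nodeSem τ η x := by
  let s : Set (PathE A) := allN (somewhere η) ∪ {.eps}
  have hs : StpClosed s := (allN_closed _).union StpClosed.eps
  have he : .eps ∈ s := Or.inr rfl
  have : Finite s := ((allN_finite _).union (Set.finite_singleton _)).to_subtype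
  obtain ⟨δ, hδ⟩ := auto_iff
    (fun c : Core A s => opS s (fun φ => allN φ ⊆ s ∧ evalN s c.lab c.W φ)) ⟨.eps, he⟩
    (fun c => evalN s c.lab c.W (somewhere η))
  refine ⟨⟨Core A s × Core A s, inferInstance, Option (Cl s), inferInstance, none, δ⟩,
    fun D τ => ?_⟩
  rw [← somewhere_iff, ← good_iff τ (somewhere η) hs he Set.subset_union_left]
  exact hδ D τ

end Final

/-- **From vertical regXPath(𝔙,=) to BUDTA**: for every finite alphabet `A`
(and infinite data domain `D`) there is a (computable) translation taking each
node expression `η` to a BUDTA equivalent to it: the automaton accepts a data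
tree over `A` and `D` iff `η` holds at some position of the tree. -/
theorem regXPath_to_BUDTA (A D : Type) [Fintype A] [Infinite D] :
    ∃ F : NodeE A → BUDTA A,
      ∀ (η : NodeE A) (τ : DataTree A D),
        Accepts (F η) τ ↔ ∃ x ∈ τ.pos, nodeSem τ η x := by
  choose F hF using fun η : NodeE A => exists_budta η
  exact ⟨F, fun η τ => hF η D τ⟩

end XPB
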